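/- Let K ⊂ ℝⁿ be a compact set with |K| > 0 and 0 in the interior of the convex hull of K. If z is a point in the interior of K° minimizing the function w ↦ |(K° − w)°| over the interior of K°, then |K|·|K°| ≤ |B₂ⁿ|² · (1 − ⟨z, bar(K)⟩)^{n+1}. -/

import Mathlib

open MeasureTheory Set
open scoped RealInnerProductSpace ENNReal

/-- The polar of a set `A ⊆ ℝⁿ`: `A° = {y : ⟨x,y⟩ ≤ 1 for all x ∈ A}`. -/
def polarSet {n : ℕ} (A : Set (EuclideanSpace ℝ (Fin n))) : Set (EuclideanSpace ℝ (Fin n)) :=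
  {y | ∀ x ∈ A, ⟪x, y⟫ ≤ 1}

theorem volume_add_le_of_isCompact {A B C : Set ℝ} (hA : IsCompact A) (hB : IsCompact B)
    (hA0 : A.Nonempty) (hB0 : B.Nonempty) (h : ∀ a ∈ A, ∀ b ∈ B, a + b ∈ C) :
    volume A + volume B ≤ volume C := by
  have ha := hA.sSup_mem hA0
  have hb := hB.sInf_mem hB0
  set a := sSup A
  set b := sInf B
  have h1 : volume A ≤ volume (C ∩ Iic (a + b)) := by
    rw [← measure_preimage_add_right volume b (C ∩ Iic (a + b))]
    refine measure_mono fun x hx => ⟨h x hx b hb, ?_⟩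
    simpa using le_csSup hA.bddAbove hx
  have h2 : volume B ≤ volume (C \ Iic (a + b)) := by
    have h3 : volume B ≤ volume ((C \ Iic (a + b)) ∪ {a + b}) := by
      rw [← measure_preimage_add volume a (_ ∪ _)]
      refine measure_mono fun x hx => ?_
      have hbx : b ≤ x := csInf_le hB.bddBelow hx
      rcases hbx.eq_or_lt with h' | h'
      · right; simp [h']
      · left; exact ⟨h a ha x hx, by simpa using h'⟩
    refine h3.trans ((measure_union_le _ _).trans ?_)
    simp
  rw [← measure_inter_add_sdiff C (measurableSet_Iic (a := a + b))]
  exact add_le_add h1 h2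

/-- The one-dimensional Brunn-Minkowski inequality. -/
theorem volume_add_le_two_mul {A B C : Set ℝ} (hA : MeasurableSet A) (hB : MeasurableSet B)
    (hA0 : A.Nonempty) (hB0 : B.Nonempty) (h : ∀ a ∈ A, ∀ b ∈ B, (a + b) / 2 ∈ C) :
    volume A + volume B ≤ 2 * volume C := by
  have hC : volume ((fun x : ℝ => (2 : ℝ)⁻¹ • x) ⁻¹' C) = 2 * volume C := by
    rw [Measure.addHaar_preimage_smul _ (by norm_num)]
    simp
  rw [← hC]
  obtain ⟨a₀, ha₀⟩ := hA0
  obtain ⟨b₀, hb₀⟩ := hB0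
  rw [hA.measure_eq_iSup_isCompact, hB.measure_eq_iSup_isCompact]
  simp_rw [iSup_and']
  refine ENNReal.biSup_add_biSup_le' ⟨∅, by simp⟩ ⟨∅, by simp⟩ fun S hS T hT => ?_
  refine (add_le_add (measure_mono (subset_insert a₀ S))
    (measure_mono (subset_insert b₀ T))).trans ?_
  refine volume_add_le_of_isCompact (hS.2.insert a₀) (hT.2.insert b₀) (insert_nonempty _ _)
    (insert_nonempty _ _) fun a ha b hb => ?_
  have := h a (insert_subset ha₀ hS.1 ha) b (insert_subset hb₀ hT.1 hb)
  rwa [mem_preimage, smul_eq_mul, ← div_eq_inv_mul]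

theorem four_mul_le_add_sq (a b : ℝ≥0∞) : 4 * (a * b) ≤ (a + b) ^ 2 := by
  by_cases ha : a = ∞
  · simp [ha]
  by_cases hb : b = ∞
  · simp [hb]
  lift a to NNReal using ha
  lift b to NNReal using hb
  norm_cast
  rw [← NNReal.coe_le_coe]
  push_cast
  nlinarith [sq_nonneg ((a : ℝ) - b)]

theorem lintegral_mul_le_of_normalized {F G H : ℝ → ℝ} (hF : Measurable F) (hG : Measurable G)
    (hH : Measurable H) (hF0 : ∀ x, 0 ≤ F x) (hG0 : ∀ x, 0 ≤ G x) (hH0 : ∀ x, 0 ≤ H x)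
    (hF1 : ∀ x, F x ≤ 1) (hG1 : ∀ x, G x ≤ 1)
    (hF2 : ∀ t < 1, ∃ x, t < F x) (hG2 : ∀ t < 1, ∃ x, t < G x)
    (h : ∀ a b, F a * G b ≤ H ((a + b) / 2) ^ 2) :
    (∫⁻ x, ENNReal.ofReal (F x)) * (∫⁻ x, ENNReal.ofReal (G x))
      ≤ (∫⁻ x, ENNReal.ofReal (H x)) ^ 2 := by
  have key : (∫⁻ x, ENNReal.ofReal (F x)) + (∫⁻ x, ENNReal.ofReal (G x))
      ≤ 2 * (∫⁻ x, ENNReal.ofReal (H x)) := by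
    rw [lintegral_eq_lintegral_meas_lt volume (ae_of_all _ hF0) hF.aemeasurable,
      lintegral_eq_lintegral_meas_lt volume (ae_of_all _ hG0) hG.aemeasurable,
      lintegral_eq_lintegral_meas_lt volume (ae_of_all _ hH0) hH.aemeasurable,
      ← lintegral_const_mul' _ _ (by simp), ← lintegral_add_left']
    · refine setLIntegral_mono' measurableSet_Ioi fun t (ht : 0 < t) => ?_
      rcases lt_or_ge t 1 with ht1 | ht1
      · refine volume_add_le_two_mul (measurableSet_lt measurable_const hF)
          (measurableSet_lt measurable_const hG) (hF2 t ht1) (hG2 t ht1) ?_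
        intro a (ha : t < F a) b (hb : t < G b)
        have h1 := h a b
        have h2 : t * t < F a * G b := mul_lt_mul'' ha hb ht.le ht.le
        exact lt_of_pow_lt_pow_left₀ 2 (hH0 _) (by nlinarith)
      · have e1 : {a | t < F a} = ∅ := by
          ext a; simpa using (hF1 a).trans ht1
        have e2 : {a | t < G a} = ∅ := by
          ext a; simpa using (hG1 a).trans ht1
        simp [e1, e2]
    · refine Antitone.measurable (fun s t hst => measure_mono fun a (ha : t < F a) => ?_)
        |>.aemeasurable
      exact lt_of_le_of_lt hst ha
  have h4 : 4 * ((∫⁻ x, ENNReal.ofReal (F x)) * (∫⁻ x, ENNReal.ofReal (G x)))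
      ≤ 4 * (∫⁻ x, ENNReal.ofReal (H x)) ^ 2 := by
    refine (four_mul_le_add_sq _ _).trans ((pow_le_pow_left' key 2).trans_eq ?_)
    ring
  exact (ENNReal.mul_le_mul_iff_right (by simp) (by simp)).1 h4

/-- The one-dimensional Prékopa-Leindler inequality with weights one half. -/
theorem lintegral_mul_le_sq_lintegral {F G H : ℝ → ℝ} (hF : Measurable F) (hG : Measurable G)
    (hH : Measurable H) (hF0 : ∀ x, 0 ≤ F x) (hG0 : ∀ x, 0 ≤ G x) (hH0 : ∀ x, 0 ≤ H x)
    (hF1 : BddAbove (range F)) (hG1 : BddAbove (range G))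
    (h : ∀ a b, F a * G b ≤ H ((a + b) / 2) ^ 2) :
    (∫⁻ x, ENNReal.ofReal (F x)) * (∫⁻ x, ENNReal.ofReal (G x))
      ≤ (∫⁻ x, ENNReal.ofReal (H x)) ^ 2 := by
  have aux : ∀ {F : ℝ → ℝ}, (∀ x, 0 ≤ F x) → BddAbove (range F) →
      ¬ (0 < sSup (range F)) → ∫⁻ x, ENNReal.ofReal (F x) = 0 := by
    intro F hF0 hF1 hn
    have : ∀ x, F x = 0 := fun x =>
      le_antisymm ((le_csSup hF1 (mem_range_self x)).trans (not_lt.1 hn)) (hF0 x)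
    simp [this]
  by_cases hMF : 0 < sSup (range F)
  swap
  · simp [aux hF0 hF1 hMF]
  by_cases hMG : 0 < sSup (range G)
  swap
  · simp [aux hG0 hG1 hMG]
  set M := sSup (range F) with hM
  set N := sSup (range G) with hN
  have hs : 0 < √(M * N) := Real.sqrt_pos.2 (mul_pos hMF hMG)
  have := lintegral_mul_le_of_normalized (F := fun x => M⁻¹ * F x) (G := fun x => N⁻¹ * G x)
    (H := fun x => (√(M * N))⁻¹ * H x) (hF.const_mul _) (hG.const_mul _) (hH.const_mul _)
    (fun x => mul_nonneg (by positivity) (hF0 x)) (fun x => mul_nonneg (by positivity) (hG0 x))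
    (fun x => mul_nonneg (by positivity) (hH0 x))
    (fun x => by
      rw [inv_mul_le_iff₀ hMF, mul_one]; exact le_csSup hF1 (mem_range_self x))
    (fun x => by
      rw [inv_mul_le_iff₀ hMG, mul_one]; exact le_csSup hG1 (mem_range_self x))
    (fun t ht => by
      obtain ⟨_, ⟨x, rfl⟩, hx⟩ := exists_lt_of_lt_csSup (range_nonempty F)
        (show M * t < sSup (range F) by rw [← hM]; nlinarith)
      exact ⟨x, by rwa [lt_inv_mul_iff₀ hMF]⟩)
    (fun t ht => by
      obtain ⟨_, ⟨x, rfl⟩, hx⟩ := exists_lt_of_lt_csSup (range_nonempty G)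
        (show N * t < sSup (range G) by rw [← hN]; nlinarith)
      exact ⟨x, by rwa [lt_inv_mul_iff₀ hMG]⟩)
    (fun a b => by
      rw [mul_pow, inv_pow, Real.sq_sqrt (by positivity), mul_inv]
      have := h a b
      calc _ = M⁻¹ * N⁻¹ * (F a * G b) := by ring
        _ ≤ _ := by gcongr)
  simp only [ENNReal.ofReal_mul (inv_nonneg.2 hMF.le), ENNReal.ofReal_mul (inv_nonneg.2 hMG.le),
    ENNReal.ofReal_mul (inv_nonneg.2 hs.le)] at this
  rw [lintegral_const_mul' _ _ (by simp), lintegral_const_mul' _ _ (by simp),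
    lintegral_const_mul' _ _ (by simp), mul_pow, ← ENNReal.ofReal_pow (by positivity), inv_pow,
    Real.sq_sqrt (by positivity), mul_mul_mul_comm, ← ENNReal.ofReal_mul (by positivity),
    ← mul_inv] at this
  exact (ENNReal.mul_le_mul_iff_right (by
    rw [Ne, ENNReal.ofReal_eq_zero, not_le]; positivity) (by simp)).1 this

theorem lintegral_Ioi_eq_lintegral_exp (f : ℝ → ℝ≥0∞) :
    ∫⁻ x in Ioi 0, f x = ∫⁻ a, ENNReal.ofReal (Real.exp a) * f (Real.exp a) := by
  have := lintegral_image_eq_lintegral_abs_deriv_mul (s := univ) (f := Real.exp)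
    (f' := Real.exp) MeasurableSet.univ (fun x _ => (Real.hasDerivAt_exp x).hasDerivWithinAt)
    Real.exp_injective.injOn f
  simpa [image_univ, Real.range_exp] using this

theorem lintegral_Ioi_exp_neg_sq :
    ∫⁻ x in Ioi (0 : ℝ), ENNReal.ofReal (Real.exp (-(1 / 2) * x ^ 2))
      = ENNReal.ofReal √(Real.pi / 2) := by
  rw [← ofReal_integral_eq_lintegral_ofReal]
  · rw [integral_gaussian_Ioi]
    congr 1
    rw [show Real.pi / (1 / 2) = 2 ^ 2 * (Real.pi / 2) by ring, Real.sqrt_mul (by positivity),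
      Real.sqrt_sq (by positivity)]
    ring
  · exact (integrable_exp_neg_mul_sq (by norm_num)).integrableOn
  · exact ae_of_all _ fun x => (Real.exp_pos _).le

/-- The Prékopa-Leindler inequality on a half-line in multiplicative form, for the Gaussian. -/
theorem lintegral_Ioi_mul_le {f g : ℝ → ℝ≥0∞} (hf : Measurable f) (hg : Measurable g) {c : ℝ}
    (hc : 0 ≤ c)
    (h : ∀ s > 0, ∀ t > 0, f s * g t ≤ ENNReal.ofReal (c * Real.exp (-(s * t)))) :
    (∫⁻ x in Ioi 0, f x) * (∫⁻ x in Ioi 0, g x) ≤ ENNReal.ofReal (c * (Real.pi / 2)) := by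
  by_cases hf0 : ∀ s > 0, f s = 0
  · have : ∫⁻ x in Ioi 0, f x = 0 := by
      rw [setLIntegral_congr_fun measurableSet_Ioi (g := 0) (fun x hx => hf0 x hx)]; simp
    simp [this]
  by_cases hg0 : ∀ s > 0, g s = 0
  · have : ∫⁻ x in Ioi 0, g x = 0 := by
      rw [setLIntegral_congr_fun measurableSet_Ioi (g := 0) (fun x hx => hg0 x hx)]; simp
    simp [this]
  push Not at hf0 hg0
  obtain ⟨s₀, hs₀, hfs⟩ := hf0
  obtain ⟨t₀, ht₀, hgt⟩ := hg0
  have hfin : ∀ s > 0, f s ≠ ∞ := fun s hs hs' => by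
    have := h s hs t₀ ht₀
    simp [hs', ENNReal.top_mul hgt] at this
  have hgin : ∀ s > 0, g s ≠ ∞ := fun s hs hs' => by
    have := h s₀ hs₀ s hs
    simp [hs', ENNReal.mul_top hfs] at this
  have hr : ∀ s > 0, ∀ t > 0, (f s).toReal * (g t).toReal ≤ c * Real.exp (-(s * t)) := by
    intro s hs t ht
    rw [← ENNReal.toReal_mul]
    exact ENNReal.toReal_le_of_le_ofReal (by positivity) (h s hs t ht)
  set F : ℝ → ℝ := fun a => Real.exp a * (f (Real.exp a)).toReal with hF
  set G : ℝ → ℝ := fun a => Real.exp a * (g (Real.exp a)).toReal with hG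
  set H : ℝ → ℝ := fun a => √c * (Real.exp a * Real.exp (-(1 / 2) * (Real.exp a) ^ 2)) with hH
  have hFGH : ∀ a b, F a * G b ≤ H ((a + b) / 2) ^ 2 := by
    intro a b
    have h1 := hr _ (Real.exp_pos a) _ (Real.exp_pos b)
    have h2 : Real.exp ((a + b) / 2) ^ 2 = Real.exp a * Real.exp b := by
      rw [← Real.exp_add, ← Real.exp_nat_mul]; congr 1; push_cast; ring
    have h3 : H ((a + b) / 2) ^ 2
        = c * (Real.exp a * Real.exp b * Real.exp (-(Real.exp a * Real.exp b))) := by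
      simp only [hH]
      rw [mul_pow, Real.sq_sqrt hc, mul_pow, h2, ← Real.exp_nat_mul]
      congr 3; push_cast; ring
    rw [h3]
    calc F a * G b = Real.exp a * Real.exp b
          * ((f (Real.exp a)).toReal * (g (Real.exp b)).toReal) := by simp only [hF, hG]; ring
      _ ≤ Real.exp a * Real.exp b * (c * Real.exp (-(Real.exp a * Real.exp b))) := by gcongr
      _ = _ := by ring
  have hHb : ∀ u, H u ^ 2 ≤ c := by
    intro u
    simp only [hH]
    rw [mul_pow, Real.sq_sqrt hc]
    refine mul_le_of_le_one_right hc (pow_le_one₀ (by positivity) ?_)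
    have h1 : Real.exp u ≤ Real.exp ((1 / 2) * Real.exp u ^ 2) := by
      refine le_trans ?_ (Real.add_one_le_exp _)
      nlinarith [sq_nonneg (Real.exp u - 1)]
    calc _ ≤ Real.exp ((1 / 2) * Real.exp u ^ 2) * Real.exp (-(1 / 2) * (Real.exp u) ^ 2) := by
          gcongr
      _ = 1 := by rw [← Real.exp_add]; simp
  have hFs : 0 < F (Real.log s₀) := by
    simp only [hF, Real.exp_log hs₀]
    exact mul_pos hs₀ (ENNReal.toReal_pos hfs (hfin _ hs₀))
  have hGt : 0 < G (Real.log t₀) := by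
    simp only [hG, Real.exp_log ht₀]
    exact mul_pos ht₀ (ENNReal.toReal_pos hgt (hgin _ ht₀))
  have main := lintegral_mul_le_sq_lintegral (F := F) (G := G) (H := H)
    (by fun_prop) (by fun_prop) (by fun_prop) (fun x => by positivity) (fun x => by positivity)
    (fun x => by positivity)
    ⟨c / G (Real.log t₀), by
      rintro _ ⟨x, rfl⟩
      rw [le_div_iff₀ hGt]; exact (hFGH _ _).trans (hHb _)⟩
    ⟨c / F (Real.log s₀), by
      rintro _ ⟨x, rfl⟩
      rw [le_div_iff₀ hFs, mul_comm]; exact (hFGH _ _).trans (hHb _)⟩ hFGH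
  have e1 : ∫⁻ x in Ioi 0, f x = ∫⁻ x, ENNReal.ofReal (F x) := by
    rw [lintegral_Ioi_eq_lintegral_exp]
    refine lintegral_congr fun a => ?_
    rw [ENNReal.ofReal_mul (Real.exp_pos a).le, ENNReal.ofReal_toReal (hfin _ (Real.exp_pos a))]
  have e2 : ∫⁻ x in Ioi 0, g x = ∫⁻ x, ENNReal.ofReal (G x) := by
    rw [lintegral_Ioi_eq_lintegral_exp]
    refine lintegral_congr fun a => ?_
    rw [ENNReal.ofReal_mul (Real.exp_pos a).le, ENNReal.ofReal_toReal (hgin _ (Real.exp_pos a))]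
  have e3 : ∫⁻ x, ENNReal.ofReal (H x) = ENNReal.ofReal (√c * √(Real.pi / 2)) := by
    simp only [hH, ENNReal.ofReal_mul (Real.sqrt_nonneg c)]
    rw [lintegral_const_mul' _ _ (by simp), ← lintegral_Ioi_exp_neg_sq,
      lintegral_Ioi_eq_lintegral_exp]
    simp only [ENNReal.ofReal_mul (Real.exp_pos _).le]
  rw [e1, e2]
  refine main.trans_eq ?_
  rw [e3, ← ENNReal.ofReal_pow (by positivity), mul_pow, Real.sq_sqrt hc,
    Real.sq_sqrt (by positivity)]

open Filter Topology in
theorem exists_integral_Iio_eq_integral_Ioi {h : ℝ → ℝ} (hi : Integrable h) (h0 : 0 ≤ h) :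
    ∃ t, ∫ s in Iio t, h s = ∫ s in Ioi t, h s := by
  set P := ∫ s in Ioi 0, h s with hP
  set N := ∫ s in Iic 0, h s with hN
  have hP0 : 0 ≤ P := integral_nonneg h0
  have hN0 : 0 ≤ N := integral_nonneg h0
  have hcont : Continuous fun t => ∫ s in (0 : ℝ)..t, h s :=
    intervalIntegral.continuous_primitive (fun a b => hi.intervalIntegrable) 0
  have htop : Tendsto (fun t => ∫ s in (0 : ℝ)..t, h s) atTop (𝓝 P) :=
    intervalIntegral_tendsto_integral_Ioi 0 hi.integrableOn tendsto_id
  have hbot : Tendsto (fun t => ∫ s in (0 : ℝ)..t, h s) atBot (𝓝 (-N)) := by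
    have := (intervalIntegral_tendsto_integral_Iic 0 hi.integrableOn
      (tendsto_id (α := ℝ) (x := atBot))).neg
    refine this.congr fun t => ?_
    simp [intervalIntegral.integral_symm 0 t]
  have hex : ∃ t, ∫ s in (0 : ℝ)..t, h s = (P - N) / 2 := by
    rcases (add_nonneg hP0 hN0).eq_or_lt with hz | hpos
    · exact ⟨0, by simp; linarith⟩
    · obtain ⟨a, ha⟩ := (hbot.eventually (gt_mem_nhds (show -N < (P - N) / 2 by linarith))).exists
      obtain ⟨b, hb⟩ := (htop.eventually (lt_mem_nhds (show (P - N) / 2 < P by linarith))).exists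
      exact mem_range_of_exists_le_of_exists_ge hcont ⟨a, ha.le⟩ ⟨b, hb.le⟩
  obtain ⟨t, ht⟩ := hex
  refine ⟨t, ?_⟩
  have h1 := intervalIntegral.integral_Iic_sub_Iic (a := 0) (b := t) (f := h) (μ := volume)
    hi.integrableOn hi.integrableOn
  have h2 := intervalIntegral.integral_Iic_add_Ioi (b := t) (f := h) (μ := volume)
    hi.integrableOn hi.integrableOn
  have h3 := intervalIntegral.integral_Iic_add_Ioi (b := 0) (f := h) (μ := volume)
    hi.integrableOn hi.integrableOn
  rw [← integral_Iic_eq_integral_Iio]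
  linarith

theorem ofReal_integral_le_lintegral {α : Type*} [MeasurableSpace α] {μ : Measure α}
    (f : α → ℝ) : ENNReal.ofReal (∫ x, f x ∂μ) ≤ ∫⁻ x, ENNReal.ofReal (f x) ∂μ := by
  by_cases hf : Integrable f μ
  · rw [integral_eq_lintegral_pos_part_sub_lintegral_neg_part hf]
    exact (ENNReal.ofReal_le_ofReal (sub_le_self _ ENNReal.toReal_nonneg)).trans
      ENNReal.ofReal_toReal_le
  · simp [integral_undef hf]

theorem lintegral_le_lintegral_mul_exp {α : Type*} [MeasurableSpace α] {μ : Measure α}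
    {f l : α → ℝ} (hf0 : ∀ x, 0 ≤ f x) (hf : Integrable f μ)
    (hl : Integrable (fun x => l x * f x) μ) (hl0 : ∫ x, l x * f x ∂μ = 0) :
    ∫⁻ x, ENNReal.ofReal (f x) ∂μ ≤ ∫⁻ x, ENNReal.ofReal (f x * Real.exp (l x)) ∂μ := by
  rw [← ofReal_integral_eq_lintegral_ofReal hf (ae_of_all _ hf0)]
  have : ∫ x, f x ∂μ = ∫ x, (f x + l x * f x) ∂μ := by
    rw [integral_add hf hl, hl0, add_zero]
  rw [this]
  refine (ofReal_integral_le_lintegral _).trans (lintegral_mono fun x => ?_)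
  refine ENNReal.ofReal_le_ofReal ?_
  nlinarith [hf0 x, Real.add_one_le_exp (l x)]

/-- The functional Santaló inequality on `ℝⁿ` for a function `f` with barycenter at the origin. -/
def FunctionalSantalo (n : ℕ) : Prop :=
  ∀ (f : (Fin n → ℝ) → ℝ) (g : (Fin n → ℝ) → ℝ≥0∞), Measurable f → Measurable g →
    (∀ x, 0 ≤ f x) → Integrable f → (∀ i, Integrable fun x => x i * f x) →
    (∀ i, ∫ x, x i * f x = 0) →
    (∀ x y, ENNReal.ofReal (f x) * g y ≤ ENNReal.ofReal (Real.exp (-(x ⬝ᵥ y)))) →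
    (∫⁻ x, ENNReal.ofReal (f x)) * (∫⁻ x, g x) ≤ ENNReal.ofReal ((2 * Real.pi) ^ n)

theorem functionalSantalo_zero : FunctionalSantalo 0 := by
  intro f g hf hg hf0 hfi _ _ h
  have hv : volume (univ : Set (Fin 0 → ℝ)) = 1 := by simp [volume_pi]
  rw [lintegral_unique, lintegral_unique, hv, mul_one, mul_one]
  have hx : ∀ x y, ENNReal.ofReal (f x) * g y ≤ ENNReal.ofReal ((2 * Real.pi) ^ 0) :=
    fun x y => (h x y).trans_eq (by simp [dotProduct])
  exact hx _ _

theorem FunctionalSantalo.halfSpace {n : ℕ} (hn : FunctionalSantalo n)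
    {f : ℝ × (Fin n → ℝ) → ℝ≥0∞} {g : ℝ × (Fin n → ℝ) → ℝ} (hf : Measurable f)
    (hg : Measurable g) (hg0 : ∀ p, 0 ≤ g p)
    (hgi : Integrable g ((volume.restrict (Ioi 0)).prod volume))
    (hgy : ∀ i, Integrable (fun p : ℝ × (Fin n → ℝ) => p.2 i * g p) ((volume.restrict (Ioi 0)).prod volume))
    (hgb : ∀ i, ∫ p : ℝ × (Fin n → ℝ), p.2 i * g p ∂((volume.restrict (Ioi 0)).prod volume) = 0)
    (h : ∀ s > 0, ∀ t > 0, ∀ x y, f (s, x) * ENNReal.ofReal (g (t, y))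
      ≤ ENNReal.ofReal (Real.exp (-(s * t + x ⬝ᵥ y)))) :
    (∫⁻ p, f p ∂((volume.restrict (Ioi 0)).prod volume))
      * (∫⁻ p, ENNReal.ofReal (g p) ∂((volume.restrict (Ioi 0)).prod volume))
      ≤ ENNReal.ofReal ((2 * Real.pi) ^ n * (Real.pi / 2)) := by
  have hpi : 0 < Real.pi / 2 := by positivity
  have hpi0 : ENNReal.ofReal (Real.pi / 2) ≠ 0 := by
    rw [Ne, ENNReal.ofReal_eq_zero, not_le]; exact hpi
  have key := hn (fun y => ∫ s in Ioi 0, g (s, y))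
    (fun x => (ENNReal.ofReal (Real.pi / 2))⁻¹ * ∫⁻ s in Ioi 0, f (s, x))
    (hg.stronglyMeasurable.integral_prod_left').measurable
    ((hf.lintegral_prod_left').const_mul _)
    (fun y => integral_nonneg fun s => hg0 _)
    hgi.integral_prod_right
    (fun i => by
      simpa only [integral_const_mul] using (hgy i).integral_prod_right)
    (fun i => by
      have h1 := integral_prod_symm _ (hgy i)
      rw [hgb i] at h1
      simpa only [integral_const_mul] using h1.symm)
    (fun y x => by
      have h1 : ENNReal.ofReal (∫ s in Ioi 0, g (s, y)) * ∫⁻ s in Ioi 0, f (s, x)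
          ≤ ENNReal.ofReal (Real.exp (-(y ⬝ᵥ x)) * (Real.pi / 2)) := by
        refine (mul_le_mul_left (ofReal_integral_le_lintegral _) _).trans ?_
        refine lintegral_Ioi_mul_le (f := fun s => ENNReal.ofReal (g (s, y)))
          (g := fun s => f (s, x)) (by fun_prop) (by fun_prop) (Real.exp_pos _).le ?_
        intro s hs t ht
        rw [mul_comm, ← Real.exp_add]
        refine (h t ht s hs x y).trans_eq ?_
        rw [dotProduct_comm, mul_comm]
        congr 2; ring
      calc _ = (ENNReal.ofReal (Real.pi / 2))⁻¹ *
            (ENNReal.ofReal (∫ s in Ioi 0, g (s, y)) * ∫⁻ s in Ioi 0, f (s, x)) := by ring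
        _ ≤ (ENNReal.ofReal (Real.pi / 2))⁻¹ *
            ENNReal.ofReal (Real.exp (-(y ⬝ᵥ x)) * (Real.pi / 2)) := by gcongr
        _ = _ := by
          rw [mul_comm (Real.exp _), ENNReal.ofReal_mul hpi.le, ← mul_assoc,
            ENNReal.inv_mul_cancel hpi0 (by simp), one_mul])
  rw [lintegral_const_mul' _ _ (by simpa using hpi0)] at key
  have e1 : ∫⁻ y, ENNReal.ofReal (∫ s in Ioi 0, g (s, y))
      = ∫⁻ p, ENNReal.ofReal (g p) ∂((volume.restrict (Ioi 0)).prod volume) := by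
    rw [← ofReal_integral_eq_lintegral_ofReal hgi (ae_of_all _ hg0), integral_prod_symm _ hgi,
      ← ofReal_integral_eq_lintegral_ofReal hgi.integral_prod_right
        (ae_of_all _ fun y => integral_nonneg fun s => hg0 _)]
  have e2 : ∫⁻ x, ∫⁻ s in Ioi 0, f (s, x) = ∫⁻ p, f p ∂((volume.restrict (Ioi 0)).prod volume) := by
    rw [lintegral_prod_symm' _ hf]
  rw [e1, e2] at key
  calc _ = ENNReal.ofReal (Real.pi / 2) * (
        (∫⁻ p, ENNReal.ofReal (g p) ∂((volume.restrict (Ioi 0)).prod volume)) *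
        ((ENNReal.ofReal (Real.pi / 2))⁻¹ *
          ∫⁻ p, f p ∂((volume.restrict (Ioi 0)).prod volume))) := by
        rw [mul_left_comm, ← mul_assoc (ENNReal.ofReal _) _⁻¹, ENNReal.mul_inv_cancel hpi0 (by simp),
          one_mul, mul_comm]
    _ ≤ ENNReal.ofReal (Real.pi / 2) * ENNReal.ofReal ((2 * Real.pi) ^ n) := by gcongr
    _ = _ := by rw [← ENNReal.ofReal_mul hpi.le, mul_comm]

theorem restrict_Ioi_add_map_neg :
    (volume : Measure ℝ) = volume.restrict (Ioi 0) + (volume.restrict (Ioi 0)).map Neg.neg := by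
  have h1 : (volume.restrict (Ioi (0 : ℝ))).map Neg.neg = volume.restrict (Iic 0) := by
    have := (Measure.measurePreserving_neg (volume : Measure ℝ)).restrict_preimage
      (measurableSet_Iio (a := (0 : ℝ)))
    rw [Set.neg_preimage, Set.neg_Iio, neg_zero] at this
    rw [this.map_eq, Measure.restrict_congr_set Iio_ae_eq_Iic]
  rw [h1, ← compl_Ioi, Measure.restrict_add_restrict_compl measurableSet_Ioi]

theorem volume_eq_add_map_reflection (n : ℕ) :
    (volume : Measure (ℝ × (Fin n → ℝ))) = (volume.restrict (Ioi 0)).prod volume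
      + ((volume.restrict (Ioi 0)).prod volume).map (fun p => (-p.1, p.2)) := by
  have h1 : ((volume.restrict (Ioi (0 : ℝ))).prod (volume : Measure (Fin n → ℝ))).map
      (fun p => (-p.1, p.2)) = ((volume.restrict (Ioi (0 : ℝ))).map Neg.neg).prod volume := by
    have := Measure.map_prod_map (volume.restrict (Ioi (0 : ℝ))) (volume : Measure (Fin n → ℝ))
      measurable_neg measurable_id
    rw [Measure.map_id] at this
    rw [this]
    rfl
  rw [h1, ← Measure.add_prod, ← restrict_Ioi_add_map_neg]
  rfl

theorem measurePreserving_shear {n : ℕ} (μ : Measure ℝ) [SFinite μ] (z v : Fin n → ℝ) :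
    MeasurePreserving (fun p : ℝ × (Fin n → ℝ) => (p.1, p.2 + (z + p.1 • v)))
      (μ.prod volume) (μ.prod volume) := by
  refine (MeasurePreserving.id μ).skew_product (g := fun s y => y + (z + s • v)) (by fun_prop) ?_
  exact ae_of_all _ fun s => (measurePreserving_add_right volume _).map_eq

theorem MeasureTheory.MeasurePreserving.integral_comp_of_measurable {α β : Type*} [MeasurableSpace α]
    [MeasurableSpace β] {μ : Measure α} {ν : Measure β} {T : α → β} (hT : MeasurePreserving T μ ν)
    {f : β → ℝ} (hf : Measurable f) : ∫ x, f (T x) ∂μ = ∫ y, f y ∂ν := by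
  rw [← hT.map_eq, integral_map hT.measurable.aemeasurable hf.aestronglyMeasurable]

/-- After a translation and a shear, a function has equal masses on the two half-spaces
`{s > 0}` and `{s < 0}`, and the barycenters of both halves lie on the first axis. -/
theorem exists_centering {n : ℕ} {g : ℝ × (Fin n → ℝ) → ℝ} (hg : Measurable g)
    (hg0 : ∀ p, 0 ≤ g p) (hgi : Integrable g) (hgs : Integrable fun p => p.1 * g p)
    (hgy : ∀ i, Integrable fun p : ℝ × (Fin n → ℝ) => p.2 i * g p) (hpos : 0 < ∫ p, g p) :
    ∃ (t : ℝ) (z v : Fin n → ℝ),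
      (∫ p, g (t + p.1, p.2 + (z + p.1 • v)) ∂((volume.restrict (Ioi 0)).prod volume)
        = ∫ p, g (t - p.1, p.2 + (z - p.1 • v)) ∂((volume.restrict (Ioi 0)).prod volume)) ∧
      (∀ i, ∫ p : ℝ × (Fin n → ℝ), p.2 i * g (t + p.1, p.2 + (z + p.1 • v))
        ∂((volume.restrict (Ioi 0)).prod volume) = 0) ∧
      (∀ i, ∫ p : ℝ × (Fin n → ℝ), p.2 i * g (t - p.1, p.2 + (z - p.1 • v))
        ∂((volume.restrict (Ioi 0)).prod volume) = 0) := by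
  set ν : Measure (ℝ × (Fin n → ℝ)) := (volume.restrict (Ioi 0)).prod volume with hν
  obtain ⟨t, ht⟩ := exists_integral_Iio_eq_integral_Ioi (h := fun s => ∫ y, g (s, y))
    hgi.integral_prod_left (fun s => integral_nonneg fun y => hg0 _)
  have hT1 : MeasurePreserving (fun p : ℝ × (Fin n → ℝ) => (t + p.1, p.2)) ν
      ((volume.restrict (Ioi t)).prod volume) := by
    have h1 := (measurePreserving_add_left volume t).restrict_preimage
      (measurableSet_Ioi (a := t))
    rw [Set.preimage_const_add_Ioi, sub_self] at h1
    exact h1.prod (MeasurePreserving.id _)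
  have hT2 : MeasurePreserving (fun p : ℝ × (Fin n → ℝ) => (t - p.1, p.2)) ν
      ((volume.restrict (Iio t)).prod volume) := by
    have h1 := (Measure.measurePreserving_sub_left volume t).restrict_preimage
      (measurableSet_Iio (a := t))
    rw [Set.preimage_const_sub_Iio, sub_self] at h1
    exact h1.prod (MeasurePreserving.id _)
  have hle1 : (volume.restrict (Ioi t)).prod (volume : Measure (Fin n → ℝ)) ≤ volume := by
    rw [Measure.volume_eq_prod]
    exact Measure.prod_mono Measure.restrict_le_self le_rfl
  have hle2 : (volume.restrict (Iio t)).prod (volume : Measure (Fin n → ℝ)) ≤ volume := by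
    rw [Measure.volume_eq_prod]
    exact Measure.prod_mono Measure.restrict_le_self le_rfl
  set g₁ : ℝ × (Fin n → ℝ) → ℝ := fun p => g (t + p.1, p.2) with hg₁
  set g₂ : ℝ × (Fin n → ℝ) → ℝ := fun p => g (t - p.1, p.2) with hg₂
  have i1 : Integrable g₁ ν := hT1.integrable_comp_of_integrable (hgi.mono_measure hle1)
  have i2 : Integrable g₂ ν := hT2.integrable_comp_of_integrable (hgi.mono_measure hle2)
  have y1 : ∀ i, Integrable (fun p : ℝ × (Fin n → ℝ) => p.2 i * g₁ p) ν := fun i =>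
    hT1.integrable_comp_of_integrable ((hgy i).mono_measure hle1)
  have y2 : ∀ i, Integrable (fun p : ℝ × (Fin n → ℝ) => p.2 i * g₂ p) ν := fun i =>
    hT2.integrable_comp_of_integrable ((hgy i).mono_measure hle2)
  have s1 : Integrable (fun p : ℝ × (Fin n → ℝ) => p.1 * g₁ p) ν := by
    have h1 := hT1.integrable_comp_of_integrable (hgs.mono_measure hle1)
    refine (h1.sub (i1.const_mul t)).congr (ae_of_all _ fun p => ?_)
    simp [hg₁]; ring
  have s2 : Integrable (fun p : ℝ × (Fin n → ℝ) => p.1 * g₂ p) ν := by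
    have h1 := hT2.integrable_comp_of_integrable (hgs.mono_measure hle2)
    refine ((i2.const_mul t).sub h1).congr (ae_of_all _ fun p => ?_)
    simp [hg₂]; ring
  have m1 : ∫ p, g₁ p ∂ν = ∫ s in Ioi t, ∫ y, g (s, y) := by
    rw [hT1.integral_comp_of_measurable hg, integral_prod _ (hgi.mono_measure hle1)]
  have m2 : ∫ p, g₂ p ∂ν = ∫ s in Iio t, ∫ y, g (s, y) := by
    rw [hT2.integral_comp_of_measurable hg, integral_prod _ (hgi.mono_measure hle2)]
  have m12 : ∫ p, g₁ p ∂ν = ∫ p, g₂ p ∂ν := by rw [m1, m2, ht]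
  set m := ∫ p, g₁ p ∂ν with hm
  have hmpos : 0 < m := by
    have h1 : ∫ p, g p = ∫ s, ∫ y, g (s, y) := integral_prod _ hgi
    rw [← intervalIntegral.integral_Iic_add_Ioi (b := t) hgi.integral_prod_left.integrableOn
      hgi.integral_prod_left.integrableOn, integral_Iic_eq_integral_Iio, ← m1, ← m2, ← m12] at h1
    linarith
  set σ₁ := ∫ p, p.1 * g₁ p ∂ν with hσ₁
  set σ₂ := ∫ p, p.1 * g₂ p ∂ν with hσ₂
  have hae : ∀ᵐ p : ℝ × (Fin n → ℝ) ∂ν, 0 < p.1 := by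
    have : ν = volume.restrict (Ioi 0 ×ˢ univ) := by
      rw [hν, Measure.volume_eq_prod, ← Measure.prod_restrict, Measure.restrict_univ]
    rw [this]
    filter_upwards [ae_restrict_mem (measurableSet_Ioi.prod MeasurableSet.univ)] with p hp
    exact hp.1
  have hσ₂0 : 0 ≤ σ₂ := integral_nonneg_of_ae (by
    filter_upwards [hae] with p hp using mul_nonneg hp.le (hg0 _))
  have hσ₁0 : 0 < σ₁ := by
    rw [hσ₁, integral_pos_iff_support_of_nonneg_ae
      (by filter_upwards [hae] with p hp using mul_nonneg hp.le (hg0 _)) s1]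
    rw [hm, integral_pos_iff_support_of_nonneg_ae (ae_of_all _ fun p => hg0 _) i1] at hmpos
    refine hmpos.trans_le (measure_mono_ae ?_)
    filter_upwards [hae] with p hp hp1
    exact mul_ne_zero hp.ne' hp1
  have hσ : σ₁ + σ₂ ≠ 0 := by positivity
  set v : Fin n → ℝ := fun i => (∫ p, p.2 i * g₁ p ∂ν - ∫ p, p.2 i * g₂ p ∂ν) / (σ₁ + σ₂) with hv
  set z : Fin n → ℝ := fun i => (∫ p, p.2 i * g₁ p ∂ν - σ₁ * v i) / m with hz
  have hS1 := measurePreserving_shear (volume.restrict (Ioi 0)) z v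
  have hS2 := measurePreserving_shear (volume.restrict (Ioi 0)) z (-v)
  rw [← hν] at hS1 hS2
  have mg₁ : Measurable g₁ := by fun_prop
  have mg₂ : Measurable g₂ := by fun_prop
  have e1 : ∫ p, g (t + p.1, p.2 + (z + p.1 • v)) ∂ν = m :=
    hS1.integral_comp_of_measurable (f := g₁) mg₁
  have e2 : ∫ p, g (t - p.1, p.2 + (z - p.1 • v)) ∂ν = ∫ p, g₂ p ∂ν := by
    rw [← hS2.integral_comp_of_measurable (f := g₂) mg₂]
    simp [hg₂, sub_eq_add_neg]
  refine ⟨t, z, v, by rw [e1, e2, m12], fun i => ?_, fun i => ?_⟩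
  · have h1 := hS1.integral_comp_of_measurable
      (f := fun p => p.2 i * g₁ p - z i * g₁ p - v i * (p.1 * g₁ p)) (by fun_prop)
    have i3 : Integrable (fun p : ℝ × (Fin n → ℝ) => p.2 i * g₁ p - z i * g₁ p) ν :=
      (y1 i).sub (i1.const_mul _)
    rw [integral_sub i3 (s1.const_mul _), integral_sub (y1 i)
      (i1.const_mul _), integral_const_mul, integral_const_mul, ← hm, ← hσ₁] at h1
    have h2 : ∫ p, p.2 i * g₁ p ∂ν - z i * m - v i * σ₁ = 0 := by
      simp only [hz]; field_simp; ring
    rw [h2] at h1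
    rw [← h1]
    refine integral_congr_ae (ae_of_all _ fun p => ?_)
    simp [hg₁]; ring
  · have h1 := hS2.integral_comp_of_measurable
      (f := fun p => p.2 i * g₂ p - z i * g₂ p + v i * (p.1 * g₂ p)) (by fun_prop)
    have i3 : Integrable (fun p : ℝ × (Fin n → ℝ) => p.2 i * g₂ p - z i * g₂ p) ν :=
      (y2 i).sub (i2.const_mul _)
    rw [integral_add i3 (s2.const_mul _), integral_sub (y2 i)
      (i2.const_mul _), integral_const_mul, integral_const_mul, ← m12, ← hσ₂] at h1
    have h2 : ∫ p, p.2 i * g₂ p ∂ν - z i * m + v i * σ₂ = 0 := by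
      have h3 : z i * m = ∫ p, p.2 i * g₁ p ∂ν - σ₁ * v i := by
        simp only [hz]; field_simp
      have h4 : v i * (σ₁ + σ₂) = ∫ p, p.2 i * g₁ p ∂ν - ∫ p, p.2 i * g₂ p ∂ν := by
        simp only [hv]; field_simp
      linarith
    rw [h2] at h1
    rw [← h1]
    refine integral_congr_ae (ae_of_all _ fun p => ?_)
    simp [hg₂, sub_eq_add_neg]; ring

theorem measurePreserving_reflection (n : ℕ) :
    MeasurePreserving (fun p : ℝ × (Fin n → ℝ) => (-p.1, p.2)) volume volume :=
  (Measure.measurePreserving_neg (volume : Measure ℝ)).prod (MeasurePreserving.id _)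

theorem FunctionalSantalo.prod_of_real {n : ℕ} (hn : FunctionalSantalo n)
    {f g : ℝ × (Fin n → ℝ) → ℝ} (hf : Measurable f) (hg : Measurable g)
    (hf0 : ∀ p, 0 ≤ f p) (hg0 : ∀ p, 0 ≤ g p)
    (hfi : Integrable f) (hfs : Integrable fun p => p.1 * f p)
    (hfy : ∀ i, Integrable fun p : ℝ × (Fin n → ℝ) => p.2 i * f p)
    (hfs0 : ∫ p, p.1 * f p = 0) (hfy0 : ∀ i, ∫ p : ℝ × (Fin n → ℝ), p.2 i * f p = 0)
    (hgi : Integrable g) (hgs : Integrable fun p => p.1 * g p)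
    (hgy : ∀ i, Integrable fun p : ℝ × (Fin n → ℝ) => p.2 i * g p)
    (h : ∀ p q, f p * g q ≤ Real.exp (-(p.1 * q.1 + p.2 ⬝ᵥ q.2))) :
    (∫⁻ p, ENNReal.ofReal (f p)) * (∫⁻ p, ENNReal.ofReal (g p))
      ≤ ENNReal.ofReal ((2 * Real.pi) ^ (n + 1)) := by
  rcases (integral_nonneg hg0 : 0 ≤ ∫ p, g p).eq_or_lt with hz | hpos
  · rw [← ofReal_integral_eq_lintegral_ofReal hgi (ae_of_all _ hg0), ← hz]; simp
  obtain ⟨t, z, v, hm, hb1, hb2⟩ := exists_centering hg hg0 hgi hgs hgy hpos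
  set ν : Measure (ℝ × (Fin n → ℝ)) := (volume.restrict (Ioi 0)).prod volume with hν
  have hνle : ν ≤ volume := by
    rw [Measure.volume_eq_prod]
    exact Measure.prod_mono Measure.restrict_le_self le_rfl
  set g' : ℝ × (Fin n → ℝ) → ℝ := fun p => g (t + p.1, p.2 + (z + p.1 • v)) with hg'
  set f' : ℝ × (Fin n → ℝ) → ℝ≥0∞ := fun p =>
    ENNReal.ofReal (f (p.1 - p.2 ⬝ᵥ v, p.2) * Real.exp ((p.1 - p.2 ⬝ᵥ v) * t + p.2 ⬝ᵥ z)) with hf'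
  have hdot : ∀ w : Fin n → ℝ, Measurable fun x : Fin n → ℝ => x ⬝ᵥ w := fun w => by
    unfold dotProduct; fun_prop
  have hdot2 : ∀ w : Fin n → ℝ, Measurable fun p : ℝ × (Fin n → ℝ) => p.2 ⬝ᵥ w := fun w =>
    (hdot w).comp measurable_snd
  have mf' : Measurable f' := by
    have := hdot2 v
    have := hdot2 z
    fun_prop
  have mg' : Measurable g' := by fun_prop
  have hfg : ∀ a b x y, f' (a, x) * ENNReal.ofReal (g' (b, y))
      ≤ ENNReal.ofReal (Real.exp (-(a * b + x ⬝ᵥ y))) := by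
    intro a b x y
    rw [← ENNReal.ofReal_mul (mul_nonneg (hf0 _) (Real.exp_pos _).le)]
    refine ENNReal.ofReal_le_ofReal ?_
    have h1 := h (a - x ⬝ᵥ v, x) (t + b, y + (z + b • v))
    simp only [dotProduct_add, dotProduct_smul, smul_eq_mul] at h1
    calc _ = f (a - x ⬝ᵥ v, x) * g (t + b, y + (z + b • v))
          * Real.exp ((a - x ⬝ᵥ v) * t + x ⬝ᵥ z) := by simp only [hg']; ring
      _ ≤ _ := mul_le_mul_of_nonneg_right h1 (Real.exp_pos _).le
      _ = _ := by rw [← Real.exp_add]; congr 1; ring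
  have hT : MeasurePreserving (fun p : ℝ × (Fin n → ℝ) => (t + p.1, p.2 + (z + p.1 • v)))
      volume volume :=
    ((measurePreserving_add_left volume t).prod (MeasurePreserving.id _)).comp
      (measurePreserving_shear volume z v)
  have hR := measurePreserving_reflection n
  have gi : Integrable g' := hT.integrable_comp_of_integrable hgi
  have gy : ∀ i, Integrable fun p : ℝ × (Fin n → ℝ) => p.2 i * g' p := by
    intro i
    have h1 := hT.integrable_comp_of_integrable
      (((hgy i).sub (hgi.const_mul (z i - t * v i))).sub (hgs.const_mul (v i)))
    refine h1.congr (ae_of_all _ fun p => ?_)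
    simp [hg']; ring
  have gi2 : Integrable fun p : ℝ × (Fin n → ℝ) => g' (-p.1, p.2) :=
    hR.integrable_comp_of_integrable gi
  have gy2 : ∀ i, Integrable fun p : ℝ × (Fin n → ℝ) => p.2 i * g' (-p.1, p.2) :=
    fun i => hR.integrable_comp_of_integrable (gy i)
  have er : ∀ p : ℝ × (Fin n → ℝ),
      g (t - p.1, p.2 + (z - p.1 • v)) = g' (-p.1, p.2) := by
    intro p; simp [hg', sub_eq_add_neg]
  simp only [er] at hb2 hm
  have b1 := hn.halfSpace mf' mg' (fun p => hg0 _) (gi.mono_measure hνle)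
    (fun i => (gy i).mono_measure hνle) hb1 (fun s _ t _ x y => hfg s t x y)
  have b2 := hn.halfSpace (f := fun p => f' (-p.1, p.2)) (g := fun p => g' (-p.1, p.2))
    (by fun_prop) (by fun_prop) (fun p => hg0 _) (gi2.mono_measure hνle)
    (fun i => (gy2 i).mono_measure hνle) hb2
    (fun s _ t _ x y => by simpa using hfg (-s) (-t) x y)
  rw [← hν] at b1 b2
  have split : ∀ F : ℝ × (Fin n → ℝ) → ℝ≥0∞, Measurable F →
      ∫⁻ p, F p = ∫⁻ p, F p ∂ν + ∫⁻ p, F (-p.1, p.2) ∂ν := by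
    intro F hF
    rw [volume_eq_add_map_reflection, lintegral_add_measure, lintegral_map hF (by fun_prop)]
  have hM : ∫⁻ p, ENNReal.ofReal (g' p) ∂ν = ∫⁻ p, ENNReal.ofReal (g' (-p.1, p.2)) ∂ν := by
    rw [← ofReal_integral_eq_lintegral_ofReal (gi.mono_measure hνle) (ae_of_all _ fun p => hg0 _),
      ← ofReal_integral_eq_lintegral_ofReal (gi2.mono_measure hνle) (ae_of_all _ fun p => hg0 _)]
    exact congrArg _ hm
  have eg : ∫⁻ p, ENNReal.ofReal (g p) = 2 * ∫⁻ p, ENNReal.ofReal (g' p) ∂ν := by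
    rw [← hT.lintegral_comp (f := fun p => ENNReal.ofReal (g p)) (by fun_prop),
      split (fun p => ENNReal.ofReal (g' p)) (by fun_prop), ← hM, two_mul]
  have ef : ∫⁻ p, ENNReal.ofReal (f p) ≤ ∫⁻ p, f' p ∂ν + ∫⁻ p, f' (-p.1, p.2) ∂ν := by
    have el : ∀ p : ℝ × (Fin n → ℝ), (p.1 * t + p.2 ⬝ᵥ z) * f p
        = t * (p.1 * f p) + ∑ i, z i * (p.2 i * f p) := by
      intro p
      simp only [dotProduct, add_mul, Finset.sum_mul]
      congr 1
      · ring
      · exact Finset.sum_congr rfl fun i _ => by ring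
    have il : Integrable fun p : ℝ × (Fin n → ℝ) => ∑ i, z i * (p.2 i * f p) :=
      integrable_finsetSum _ fun i _ => (hfy i).const_mul _
    have h1 := lintegral_le_lintegral_mul_exp (l := fun p => p.1 * t + p.2 ⬝ᵥ z) hf0 hfi
      (by simp only [el]; exact (hfs.const_mul t).add il)
      (by
        simp only [el]
        rw [integral_add (hfs.const_mul t) il, integral_const_mul, hfs0,
          integral_finsetSum _ fun i _ => (hfy i).const_mul _]
        simp [integral_const_mul, hfy0])
    refine h1.trans_eq ?_
    have h2 : Measurable fun p : ℝ × (Fin n → ℝ) =>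
        ENNReal.ofReal (f p * Real.exp (p.1 * t + p.2 ⬝ᵥ z)) := by
      have := hdot2 z
      fun_prop
    rw [← split f' mf', Measure.volume_eq_prod, lintegral_prod_symm' _ h2,
      lintegral_prod_symm' _ mf']
    refine lintegral_congr fun x => ?_
    exact (lintegral_sub_right_eq_self (fun s => ENNReal.ofReal
      (f (s, x) * Real.exp (s * t + x ⬝ᵥ z))) (x ⬝ᵥ v)).symm
  rw [← hM] at b2
  rw [eg]
  calc _ ≤ (∫⁻ p, f' p ∂ν + ∫⁻ p, f' (-p.1, p.2) ∂ν)
        * (2 * ∫⁻ p, ENNReal.ofReal (g' p) ∂ν) := by gcongr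
    _ = 2 * ((∫⁻ p, f' p ∂ν) * (∫⁻ p, ENNReal.ofReal (g' p) ∂ν)
        + (∫⁻ p, f' (-p.1, p.2) ∂ν) * ∫⁻ p, ENNReal.ofReal (g' p) ∂ν) := by ring
    _ ≤ 2 * (ENNReal.ofReal ((2 * Real.pi) ^ n * (Real.pi / 2))
        + ENNReal.ofReal ((2 * Real.pi) ^ n * (Real.pi / 2))) := by gcongr
    _ = _ := by
      rw [← ENNReal.ofReal_add (by positivity) (by positivity),
        show (2 : ℝ≥0∞) = ENNReal.ofReal 2 by simp, ← ENNReal.ofReal_mul (by positivity)]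
      congr 1; ring

theorem FunctionalSantalo.prod {n : ℕ} (hn : FunctionalSantalo n)
    {f : ℝ × (Fin n → ℝ) → ℝ} {g : ℝ × (Fin n → ℝ) → ℝ≥0∞} (hf : Measurable f) (hg : Measurable g)
    (hf0 : ∀ p, 0 ≤ f p)
    (hfi : Integrable f) (hfs : Integrable fun p => p.1 * f p)
    (hfy : ∀ i, Integrable fun p : ℝ × (Fin n → ℝ) => p.2 i * f p)
    (hfs0 : ∫ p, p.1 * f p = 0) (hfy0 : ∀ i, ∫ p : ℝ × (Fin n → ℝ), p.2 i * f p = 0)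
    (h : ∀ p q, ENNReal.ofReal (f p) * g q
      ≤ ENNReal.ofReal (Real.exp (-(p.1 * q.1 + p.2 ⬝ᵥ q.2)))) :
    (∫⁻ p, ENNReal.ofReal (f p)) * (∫⁻ p, g p) ≤ ENNReal.ofReal ((2 * Real.pi) ^ (n + 1)) := by
  set G : ℕ → ℝ × (Fin n → ℝ) → ℝ≥0∞ := fun k =>
    (Metric.closedBall 0 (k : ℝ)).indicator fun p => min (g p) k with hG
  have mG : ∀ k, Measurable (G k) := fun k =>
    (hg.min measurable_const).indicator measurableSet_closedBall
  have monoG : Monotone G := by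
    intro k l hkl p
    simp only [hG]
    by_cases hp : p ∈ Metric.closedBall 0 (k : ℝ)
    · have hp' : p ∈ Metric.closedBall 0 (l : ℝ) :=
        Metric.closedBall_subset_closedBall (by exact_mod_cast hkl) hp
      rw [indicator_of_mem hp, indicator_of_mem hp']
      gcongr
    · rw [indicator_of_notMem hp]; exact zero_le
  have supG : ∀ p, ⨆ k, G k p = g p := by
    intro p
    refine le_antisymm (iSup_le fun k => ?_) ?_
    · exact (indicator_le_self _ _ _).trans (min_le_left _ _)
    · refine le_of_forall_lt fun c hc => ?_
      obtain ⟨k, hk⟩ := ENNReal.exists_nat_gt hc.ne_top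
      obtain ⟨l, hl⟩ := exists_nat_ge ‖p‖
      refine lt_iSup_iff.2 ⟨max k l, ?_⟩
      have hp : p ∈ Metric.closedBall 0 ((max k l : ℕ) : ℝ) := by
        rw [mem_closedBall_zero_iff]
        exact hl.trans (by exact_mod_cast le_max_right _ _)
      simp only [hG]
      rw [indicator_of_mem hp]
      refine lt_min hc (hk.trans_le ?_)
      exact_mod_cast le_max_left _ _
  have hgsup : ∫⁻ p, g p = ⨆ k, ∫⁻ p, G k p := by
    rw [← lintegral_iSup mG monoG]
    exact lintegral_congr fun p => (supG p).symm
  rw [hgsup, ENNReal.mul_iSup]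
  refine iSup_le fun k => ?_
  have Gle : ∀ p, G k p ≤ k := fun p => (indicator_le_self _ _ _).trans (min_le_right _ _)
  have Gfin : ∀ p, G k p ≠ ∞ := fun p => ((Gle p).trans_lt (by simp)).ne
  have Gle' : ∀ p, (G k p).toReal ≤ k := fun p => by
    simpa using ENNReal.toReal_mono (by simp) (Gle p)
  have eG : ∀ p, G k p = ENNReal.ofReal (G k p).toReal := fun p =>
    (ENNReal.ofReal_toReal (Gfin p)).symm
  have mGr : Measurable fun p => (G k p).toReal := (mG k).ennreal_toReal
  have hdom : ∀ l : ℝ × (Fin n → ℝ) → ℝ, Measurable l → (∀ p, |l p| ≤ max ‖p‖ 1) →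
      Integrable fun p => l p * (G k p).toReal := by
    intro l ml hl
    have h1 : Integrable ((Metric.closedBall (0 : ℝ × (Fin n → ℝ)) (k : ℝ)).indicator
        fun _ => max (k : ℝ) 1 * k) := by
      rw [integrable_indicator_iff measurableSet_closedBall]
      exact integrableOn_const (isCompact_closedBall _ _).measure_lt_top.ne
    refine h1.mono' (ml.mul mGr).aestronglyMeasurable (ae_of_all _ fun p => ?_)
    by_cases hp : p ∈ Metric.closedBall 0 (k : ℝ)
    · rw [indicator_of_mem hp, norm_mul, Real.norm_eq_abs, Real.norm_eq_abs,
        abs_of_nonneg ENNReal.toReal_nonneg]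
      refine mul_le_mul ((hl p).trans ?_) (Gle' p) ENNReal.toReal_nonneg (by positivity)
      gcongr
      exact mem_closedBall_zero_iff.1 hp
    · rw [indicator_of_notMem hp]
      simp [hG, indicator_of_notMem hp]
  rw [lintegral_congr eG]
  refine hn.prod_of_real hf mGr hf0 (fun p => ENNReal.toReal_nonneg) hfi hfs hfy hfs0 hfy0
    ?_ ?_ ?_ ?_
  · simpa using hdom (fun _ => 1) measurable_const (fun p => by simp)
  · exact hdom (fun p => p.1) measurable_fst
      (fun p => (norm_fst_le p).trans (le_max_left _ _))
  · exact fun i => hdom (fun p => p.2 i) (by fun_prop)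
      (fun p => ((norm_le_pi_norm p.2 i).trans (norm_snd_le p)).trans (le_max_left _ _))
  · intro p q
    have h1 : ENNReal.ofReal (f p) * G k q
        ≤ ENNReal.ofReal (Real.exp (-(p.1 * q.1 + p.2 ⬝ᵥ q.2))) := by
      refine le_trans ?_ (h p q)
      gcongr
      exact (indicator_le_self _ _ _).trans (min_le_left _ _)
    rw [← ENNReal.ofReal_toReal (Gfin q), ← ENNReal.ofReal_mul (hf0 p)] at h1
    exact (ENNReal.ofReal_le_ofReal_iff (Real.exp_pos _).le).1 h1

theorem FunctionalSantalo.succ {n : ℕ} (hn : FunctionalSantalo n) : FunctionalSantalo (n + 1) := by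
  intro f g hf hg hf0 hfi hfx hfx0 h
  set e := (MeasurableEquiv.piFinSuccAbove (fun _ : Fin (n + 1) => ℝ) 0).symm with he
  have hp : MeasurePreserving e volume volume :=
    (volume_preserving_piFinSuccAbove (fun _ : Fin (n + 1) => ℝ) 0).symm _
  have e0 : ∀ p : ℝ × (Fin n → ℝ), e p 0 = p.1 := fun p => by
    simp [he]
  have es : ∀ (p : ℝ × (Fin n → ℝ)) (i : Fin n), e p i.succ = p.2 i := fun p i => by
    simp [he]
  rw [← hp.lintegral_comp (f := fun x => ENNReal.ofReal (f x)) (by fun_prop),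
    ← hp.lintegral_comp hg]
  refine hn.prod (f := fun p => f (e p)) (g := fun p => g (e p)) (by fun_prop) (by fun_prop)
    (fun p => hf0 _) (hp.integrable_comp_of_integrable hfi) ?_ ?_ ?_ ?_ ?_
  · simpa only [Function.comp_def, e0] using hp.integrable_comp_of_integrable (hfx 0)
  · intro i
    simpa only [Function.comp_def, es] using hp.integrable_comp_of_integrable (hfx i.succ)
  · rw [← hfx0 0, ← hp.integral_comp' (fun x => x 0 * f x)]
    simp only [e0]
  · intro i
    rw [← hfx0 i.succ, ← hp.integral_comp' (fun x => x i.succ * f x)]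
    simp only [es]
  · intro p q
    have h1 := h (e p) (e q)
    simpa only [dotProduct, Fin.sum_univ_succ, e0, es] using h1

theorem functionalSantalo (n : ℕ) : FunctionalSantalo n := by
  induction n with
  | zero => exact functionalSantalo_zero
  | succ n ih => exact ih.succ

theorem lintegral_mul_lintegral_indicator_inv_smul {n : ℕ} {A : Set (EuclideanSpace ℝ (Fin n))}
    (hA : MeasurableSet A) {w : EuclideanSpace ℝ (Fin n) → ℝ≥0∞} (hw : Measurable w)
    {ψ : ℝ → ℝ≥0∞} (hψ : Measurable ψ) :
    ∫⁻ y, w y * ∫⁻ r in Ioi 0, A.indicator (fun _ => ψ r) (r⁻¹ • y)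
      = ∫⁻ r in Ioi 0, ψ r * ENNReal.ofReal (r ^ n) * ∫⁻ x in A, w (r • x) := by
  have hm : Measurable fun q : EuclideanSpace ℝ (Fin n) × ℝ =>
      A.indicator (fun _ => ψ q.2) (q.2⁻¹ • q.1) := by
    have : (fun q : EuclideanSpace ℝ (Fin n) × ℝ => A.indicator (fun _ => ψ q.2) (q.2⁻¹ • q.1))
        = ((fun q : EuclideanSpace ℝ (Fin n) × ℝ => q.2⁻¹ • q.1) ⁻¹' A).indicator
          fun q => ψ q.2 := by
      rfl
    rw [this]
    refine Measurable.indicator (by fun_prop) (hA.preimage ?_)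
    exact measurable_snd.inv.smul measurable_fst
  have e1 : ∀ y, w y * ∫⁻ r in Ioi 0, A.indicator (fun _ => ψ r) (r⁻¹ • y)
      = ∫⁻ r in Ioi 0, w y * A.indicator (fun _ => ψ r) (r⁻¹ • y) := fun y =>
    (lintegral_const_mul _ (hm.comp (measurable_const.prodMk measurable_id))).symm
  simp_rw [e1]
  rw [lintegral_lintegral_swap]
  · refine setLIntegral_congr_fun measurableSet_Ioi fun r hr => ?_
    have hr : 0 < r := hr
    have e2 : ∀ y, w y * A.indicator (fun _ => ψ r) (r⁻¹ • y)
        = (fun x => A.indicator (fun x => ψ r * w (r • x)) x) (r⁻¹ • y) := by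
      intro y
      by_cases hy : r⁻¹ • y ∈ A
      · simp [indicator_of_mem hy, smul_smul, hr.ne', mul_comm]
      · simp [indicator_of_notMem hy]
    have hmw : Measurable fun x => ψ r * w (r • x) := by fun_prop
    simp only [e2]
    rw [← lintegral_map (hmw.indicator hA) (by fun_prop),
      Measure.map_addHaar_smul _ (inv_ne_zero hr.ne'), lintegral_smul_measure,
      lintegral_indicator hA, lintegral_const_mul _ (by fun_prop)]
    simp only [finrank_euclideanSpace, Fintype.card_fin, inv_pow, inv_inv, smul_eq_mul]
    rw [abs_of_pos (by positivity)]
    ring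
  · exact ((hw.comp measurable_fst).mul hm).aemeasurable

theorem lintegral_mul_lintegral_Ioi {n : ℕ} {p : EuclideanSpace ℝ (Fin n) → ℝ}
    (hp : Measurable p) (hp0 : ∀ y, 0 ≤ p y) (hps : ∀ r > 0, ∀ y, p (r • y) = r * p y)
    {w : EuclideanSpace ℝ (Fin n) → ℝ≥0∞} (hw : Measurable w) (d : ℕ)
    (hws : ∀ r > 0, ∀ y, w (r • y) = ENNReal.ofReal (r ^ d) * w y)
    {ψ : ℝ → ℝ≥0∞} (hψ : Measurable ψ) :
    ∫⁻ y, w y * ∫⁻ r in Ioi (p y), ψ r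
      = (∫⁻ r in Ioi 0, ψ r * ENNReal.ofReal (r ^ (n + d))) * ∫⁻ x in {x | p x ≤ 1}, w x := by
  have hA : MeasurableSet {x | p x ≤ 1} := hp measurableSet_Iic
  rw [← lintegral_mul_const _ (by fun_prop)]
  have e1 : ∀ y, ∫⁻ r in Ioi (p y), ψ r
      = ∫⁻ r in Ioi 0, {x | p x ≤ 1}.indicator (fun _ => ψ r) (r⁻¹ • y) := by
    intro y
    have e2 : ∫⁻ r in Ioi 0, {x | p x ≤ 1}.indicator (fun _ => ψ r) (r⁻¹ • y)
        = ∫⁻ r in Ioi 0, (Ici (p y)).indicator ψ r := by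
      refine setLIntegral_congr_fun measurableSet_Ioi fun r hr => ?_
      have hr : 0 < r := hr
      have : r⁻¹ • y ∈ {x | p x ≤ 1} ↔ r ∈ Ici (p y) := by
        rw [mem_ofPred_eq, hps _ (inv_pos.2 hr), mem_Ici, inv_mul_le_iff₀ hr, mul_one]
      by_cases h : r ∈ Ici (p y)
      · rw [indicator_of_mem h, indicator_of_mem (this.2 h)]
      · rw [indicator_of_notMem h, indicator_of_notMem (mt this.1 h)]
    rw [e2, lintegral_indicator measurableSet_Ici,
      Measure.restrict_restrict measurableSet_Ici]
    refine setLIntegral_congr ?_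
    have h : (Ioi (p y) ∩ Ioi 0 : Set ℝ) =ᵐ[volume] (Ici (p y) ∩ Ioi 0 : Set ℝ) :=
      Ioi_ae_eq_Ici.inter (ae_eq_refl _)
    rwa [inter_eq_left.2 (Ioi_subset_Ioi (hp0 y))] at h
  simp_rw [e1]
  rw [lintegral_mul_lintegral_indicator_inv_smul hA hw hψ]
  refine setLIntegral_congr_fun measurableSet_Ioi fun r hr => ?_
  have hr : 0 < r := hr
  simp only [hws r hr]
  rw [lintegral_const_mul _ hw, pow_add, ENNReal.ofReal_mul (by positivity)]
  ring

theorem lintegral_Ioi_neg_deriv {φ φ' : ℝ → ℝ} {a : ℝ} (hd : ∀ x ∈ Ici a, HasDerivAt φ (-φ' x) x)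
    (h0 : ∀ x ∈ Ioi a, 0 ≤ φ' x) (ht : Filter.Tendsto φ Filter.atTop (nhds 0)) :
    ∫⁻ x in Ioi a, ENNReal.ofReal (φ' x) = ENNReal.ofReal (φ a) := by
  have h0' : ∀ x ∈ Ioi a, -φ' x ≤ 0 := fun x hx => neg_nonpos.2 (h0 x hx)
  have hi := (integrableOn_Ioi_deriv_of_nonpos' hd h0' ht).neg
  simp only [Pi.neg_def, neg_neg] at hi
  rw [← ofReal_integral_eq_lintegral_ofReal hi
    ((ae_restrict_iff' measurableSet_Ioi).2 (ae_of_all _ h0))]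
  have := integral_Ioi_of_hasDerivAt_of_nonpos' hd h0' ht
  rw [integral_neg] at this
  congr 1
  linarith

theorem lintegral_Ioi_exp_neg (a : ℝ) :
    ∫⁻ x in Ioi a, ENNReal.ofReal (Real.exp (-x)) = ENNReal.ofReal (Real.exp (-a)) := by
  refine lintegral_Ioi_neg_deriv (φ := fun x => Real.exp (-x)) (fun x _ => ?_)
    (fun x _ => (Real.exp_pos _).le) Real.tendsto_exp_neg_atTop_nhds_zero
  simpa using (hasDerivAt_neg x).exp

theorem lintegral_Ioi_mul_exp_neg_sq {a : ℝ} (ha : 0 ≤ a) :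
    ∫⁻ x in Ioi a, ENNReal.ofReal (x * Real.exp (-(x ^ 2 / 2)))
      = ENNReal.ofReal (Real.exp (-(a ^ 2 / 2))) := by
  refine lintegral_Ioi_neg_deriv (φ := fun x => Real.exp (-(x ^ 2 / 2))) (fun x _ => ?_)
    (fun x hx => mul_nonneg (ha.trans (le_of_lt hx)) (Real.exp_pos _).le) ?_
  · have h : HasDerivAt (fun x : ℝ => -(x ^ 2 / 2)) (-x) x := by
      simpa using ((hasDerivAt_pow 2 x).div_const 2).fun_neg
    simpa [mul_comm] using h.exp
  · refine Real.tendsto_exp_neg_atTop_nhds_zero.comp ?_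
    exact (Filter.tendsto_pow_atTop two_ne_zero).atTop_div_const two_pos

theorem lintegral_Ioi_exp_neg_mul_pow (n : ℕ) {a : ℝ} (ha : 0 < a) :
    ∫⁻ r in Ioi 0, ENNReal.ofReal (Real.exp (-(a * r))) * ENNReal.ofReal (r ^ n)
      = ENNReal.ofReal ((1 / a) ^ (n + 1) * n.factorial) := by
  have h := Real.integral_rpow_mul_exp_neg_mul_Ioi (a := n + 1) (by positivity) ha
  simp only [add_sub_cancel_right, Real.rpow_natCast, Real.Gamma_nat_eq_factorial] at h
  have h2 : (1 / a) ^ ((n : ℝ) + 1) = (1 / a) ^ (n + 1) := by exact_mod_cast Real.rpow_natCast _ _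
  rw [h2] at h
  have hi : IntegrableOn (fun r : ℝ => r ^ n * Real.exp (-(a * r))) (Ioi 0) := by
    by_contra hc
    rw [integral_undef hc] at h
    have : 0 < (1 / a) ^ (n + 1) * n.factorial := by positivity
    exact this.ne h
  rw [← h, ofReal_integral_eq_lintegral_ofReal hi]
  · refine setLIntegral_congr_fun measurableSet_Ioi fun r hr => ?_
    rw [mul_comm (r ^ n), ENNReal.ofReal_mul (Real.exp_pos _).le]
  · refine (ae_restrict_iff' measurableSet_Ioi).2 (ae_of_all _ fun r hr => ?_)
    have hr : 0 < r := hr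
    positivity

theorem lintegral_mul_exp_neg {n : ℕ} {p : EuclideanSpace ℝ (Fin n) → ℝ}
    (hp : Measurable p) (hp0 : ∀ y, 0 ≤ p y) (hps : ∀ r > 0, ∀ y, p (r • y) = r * p y)
    {w : EuclideanSpace ℝ (Fin n) → ℝ≥0∞} (hw : Measurable w) (d : ℕ)
    (hws : ∀ r > 0, ∀ y, w (r • y) = ENNReal.ofReal (r ^ d) * w y) :
    ∫⁻ y, w y * ENNReal.ofReal (Real.exp (-p y))
      = ENNReal.ofReal (n + d).factorial * ∫⁻ x in {x | p x ≤ 1}, w x := by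
  have h := lintegral_mul_lintegral_Ioi hp hp0 hps hw d hws
    (ψ := fun r => ENNReal.ofReal (Real.exp (-r))) (by fun_prop)
  have h1 := lintegral_Ioi_exp_neg_mul_pow (n + d) one_pos
  simp only [one_mul, div_one, one_pow] at h1
  simpa only [lintegral_Ioi_exp_neg, h1] using h

theorem lintegral_exp_neg {n : ℕ} {p : EuclideanSpace ℝ (Fin n) → ℝ}
    (hp : Measurable p) (hp0 : ∀ y, 0 ≤ p y) (hps : ∀ r > 0, ∀ y, p (r • y) = r * p y) :
    ∫⁻ y, ENNReal.ofReal (Real.exp (-p y))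
      = ENNReal.ofReal n.factorial * volume {x | p x ≤ 1} := by
  simpa using lintegral_mul_exp_neg hp hp0 hps (w := fun _ => 1) measurable_const 0 (by simp)

theorem lintegral_mul_exp_neg_sq {n : ℕ} {p : EuclideanSpace ℝ (Fin n) → ℝ}
    (hp : Measurable p) (hp0 : ∀ y, 0 ≤ p y) (hps : ∀ r > 0, ∀ y, p (r • y) = r * p y)
    {w : EuclideanSpace ℝ (Fin n) → ℝ≥0∞} (hw : Measurable w) (d : ℕ)
    (hws : ∀ r > 0, ∀ y, w (r • y) = ENNReal.ofReal (r ^ d) * w y) :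
    ∫⁻ y, w y * ENNReal.ofReal (Real.exp (-(p y ^ 2 / 2)))
      = (∫⁻ r in Ioi 0, ENNReal.ofReal (r * Real.exp (-(r ^ 2 / 2))) * ENNReal.ofReal (r ^ (n + d)))
        * ∫⁻ x in {x | p x ≤ 1}, w x := by
  have h := lintegral_mul_lintegral_Ioi hp hp0 hps hw d hws
    (ψ := fun r => ENNReal.ofReal (r * Real.exp (-(r ^ 2 / 2)))) (by fun_prop)
  simpa only [lintegral_Ioi_mul_exp_neg_sq (hp0 _)] using h

theorem lintegral_exp_neg_sq {n : ℕ} {p : EuclideanSpace ℝ (Fin n) → ℝ}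
    (hp : Measurable p) (hp0 : ∀ y, 0 ≤ p y) (hps : ∀ r > 0, ∀ y, p (r • y) = r * p y) :
    ∫⁻ y, ENNReal.ofReal (Real.exp (-(p y ^ 2 / 2)))
      = (∫⁻ r in Ioi 0, ENNReal.ofReal (r * Real.exp (-(r ^ 2 / 2))) * ENNReal.ofReal (r ^ n))
        * volume {x | p x ≤ 1} := by
  simpa using lintegral_mul_exp_neg_sq hp hp0 hps (w := fun _ => 1) measurable_const 0 (by simp)

theorem exp_neg_sq_le (t : ℝ) : Real.exp (-(t ^ 2 / 2)) ≤ Real.exp (1 / 2) * Real.exp (-t) := by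
  rw [← Real.exp_add]
  refine Real.exp_le_exp.2 ?_
  nlinarith [sq_nonneg (t - 1)]

theorem integrable_mul_exp_neg_sq {n : ℕ} {p l : EuclideanSpace ℝ (Fin n) → ℝ}
    (hp : Measurable p) (hl : Measurable l) (hi : Integrable fun y => l y * Real.exp (-p y)) :
    Integrable fun y => l y * Real.exp (-(p y ^ 2 / 2)) := by
  refine (hi.norm.const_mul (Real.exp (1 / 2))).mono' (by fun_prop) (ae_of_all _ fun y => ?_)
  simp only [norm_mul, Real.norm_eq_abs, Real.abs_exp]
  nlinarith [exp_neg_sq_le (p y), abs_nonneg (l y)]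

theorem integral_mul_exp_neg_sq_eq_zero {n : ℕ} {p l : EuclideanSpace ℝ (Fin n) → ℝ}
    (hp : Measurable p) (hp0 : ∀ y, 0 ≤ p y) (hps : ∀ r > 0, ∀ y, p (r • y) = r * p y)
    (hl : Measurable l) (hls : ∀ r > 0, ∀ y, l (r • y) = r * l y)
    (hi : Integrable fun y => l y * Real.exp (-p y)) (h0 : ∫ y, l y * Real.exp (-p y) = 0) :
    ∫ y, l y * Real.exp (-(p y ^ 2 / 2)) = 0 := by
  have hw1 : ∀ r > 0, ∀ y, ENNReal.ofReal (l (r • y))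
      = ENNReal.ofReal (r ^ 1) * ENNReal.ofReal (l y) := fun r hr y => by
    rw [hls r hr, ENNReal.ofReal_mul hr.le, pow_one]
  have hw2 : ∀ r > 0, ∀ y, ENNReal.ofReal (-l (r • y))
      = ENNReal.ofReal (r ^ 1) * ENNReal.ofReal (-l y) := fun r hr y => by
    rw [hls r hr, ← mul_neg, ENNReal.ofReal_mul hr.le, pow_one]
  have a1 := lintegral_mul_exp_neg hp hp0 hps (w := fun y => ENNReal.ofReal (l y))
    (by fun_prop) 1 hw1
  have a2 := lintegral_mul_exp_neg hp hp0 hps (w := fun y => ENNReal.ofReal (-l y))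
    (by fun_prop) 1 hw2
  have b1 := lintegral_mul_exp_neg_sq hp hp0 hps (w := fun y => ENNReal.ofReal (l y))
    (by fun_prop) 1 hw1
  have b2 := lintegral_mul_exp_neg_sq hp hp0 hps (w := fun y => ENNReal.ofReal (-l y))
    (by fun_prop) 1 hw2
  rw [integral_eq_lintegral_pos_part_sub_lintegral_neg_part hi] at h0
  rw [integral_eq_lintegral_pos_part_sub_lintegral_neg_part (integrable_mul_exp_neg_sq hp hl hi)]
  simp only [← neg_mul, ENNReal.ofReal_mul' (Real.exp_pos _).le, a1, a2, b1, b2,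
    ENNReal.toReal_mul] at h0 ⊢
  have hf : (ENNReal.ofReal (n + 1).factorial).toReal ≠ 0 := by
    rw [ENNReal.toReal_ofReal (by positivity)]; positivity
  have h1 := mul_left_cancel₀ hf (sub_eq_zero.1 h0)
  rw [h1, sub_self]

theorem two_pi_pow_eq (n : ℕ) :
    ENNReal.ofReal ((2 * Real.pi) ^ n)
      = ((∫⁻ r in Ioi 0, ENNReal.ofReal (r * Real.exp (-(r ^ 2 / 2))) * ENNReal.ofReal (r ^ n))
        * volume (Metric.ball (0 : EuclideanSpace ℝ (Fin n)) 1)) ^ 2 := by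
  have h := lintegral_exp_neg_sq (n := n) (p := fun y => ‖y‖) measurable_norm
    (fun _ => norm_nonneg _) (fun r hr y => by rw [norm_smul, Real.norm_of_nonneg hr.le])
  have hb : volume {x : EuclideanSpace ℝ (Fin n) | ‖x‖ ≤ 1}
      = volume (Metric.ball (0 : EuclideanSpace ℝ (Fin n)) 1) := by
    rw [← Measure.addHaar_unitClosedBall_eq_addHaar_unitBall]
    congr 1
    ext x; simp
  have hg := GaussianFourier.integral_rexp_neg_mul_sq_norm (V := EuclideanSpace ℝ (Fin n))
    (b := 1 / 2) (by norm_num)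
  have hpos : 0 < (Real.pi / (1 / 2)) ^ ((Module.finrank ℝ (EuclideanSpace ℝ (Fin n))) / 2 : ℝ) := by
    positivity
  have hi : Integrable fun y : EuclideanSpace ℝ (Fin n) => Real.exp (-(1 / 2) * ‖y‖ ^ 2) := by
    by_contra hc
    rw [integral_undef hc] at hg
    exact hpos.ne hg
  have h2 : ∫⁻ y : EuclideanSpace ℝ (Fin n), ENNReal.ofReal (Real.exp (-(‖y‖ ^ 2 / 2)))
      = ENNReal.ofReal (∫ y : EuclideanSpace ℝ (Fin n), Real.exp (-(1 / 2) * ‖y‖ ^ 2)) := by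
    rw [ofReal_integral_eq_lintegral_ofReal hi (ae_of_all _ fun _ => (Real.exp_pos _).le)]
    refine lintegral_congr fun y => ?_
    congr 2; ring
  rw [← hb, ← h, h2, hg, ← ENNReal.ofReal_pow hpos.le, ← Real.rpow_natCast _ 2,
    ← Real.rpow_mul (by positivity)]
  congr 1
  rw [← Real.rpow_natCast]
  congr 1
  · ring
  · simp

theorem volume_mul_volume_le_of_inner_le {n : ℕ} {p q : EuclideanSpace ℝ (Fin n) → ℝ}
    (hp : Measurable p) (hp0 : ∀ y, 0 ≤ p y) (hps : ∀ r > 0, ∀ y, p (r • y) = r * p y)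
    (hq : Measurable q) (hq0 : ∀ y, 0 ≤ q y) (hqs : ∀ r > 0, ∀ y, q (r • y) = r * q y)
    (hpq : ∀ x y, ⟪x, y⟫ ≤ p x * q y)
    (hpi : Integrable fun y => Real.exp (-p y))
    (hpx : ∀ i, Integrable fun y => y i * Real.exp (-p y))
    (hpx0 : ∀ i, ∫ y, y i * Real.exp (-p y) = 0) :
    volume {x | p x ≤ 1} * volume {x | q x ≤ 1}
      ≤ volume (Metric.ball (0 : EuclideanSpace ℝ (Fin n)) 1) ^ 2 := by
  set c := ∫⁻ r in Ioi 0, ENNReal.ofReal (r * Real.exp (-(r ^ 2 / 2))) * ENNReal.ofReal (r ^ n)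
    with hc
  have key : (∫⁻ y, ENNReal.ofReal (Real.exp (-(p y ^ 2 / 2))))
      * (∫⁻ y, ENNReal.ofReal (Real.exp (-(q y ^ 2 / 2)))) ≤ ENNReal.ofReal ((2 * Real.pi) ^ n) := by
    have hT : MeasurePreserving (MeasurableEquiv.toLp 2 (Fin n → ℝ)) volume volume :=
      PiLp.volume_preserving_toLp (Fin n)
    have hqm : Measurable fun y => ENNReal.ofReal (Real.exp (-(q y ^ 2 / 2))) := by fun_prop
    rw [← hT.lintegral_comp (f := fun y => ENNReal.ofReal (Real.exp (-(p y ^ 2 / 2)))) (by fun_prop),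
      ← hT.lintegral_comp hqm]
    refine functionalSantalo n (fun x => Real.exp (-(p (MeasurableEquiv.toLp 2 _ x) ^ 2 / 2))) _
      (by fun_prop) (hqm.comp (MeasurableEquiv.measurable _)) (fun _ => (Real.exp_pos _).le)
      ?_ ?_ ?_ ?_
    · have h1 := integrable_mul_exp_neg_sq hp (l := fun _ => 1) measurable_const (by simpa using hpi)
      simp only [one_mul] at h1
      exact hT.integrable_comp_of_integrable h1
    · exact fun i => hT.integrable_comp_of_integrable
        (integrable_mul_exp_neg_sq hp (l := fun y => y i) (by fun_prop) (hpx i))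
    · intro i
      rw [← integral_mul_exp_neg_sq_eq_zero hp hp0 hps (l := fun y => y i) (by fun_prop)
        (fun r _ y => by simp) (hpx i) (hpx0 i), ← hT.integral_comp']
      rfl
    · intro x y
      rw [← ENNReal.ofReal_mul (Real.exp_pos _).le, ← Real.exp_add]
      refine ENNReal.ofReal_le_ofReal (Real.exp_le_exp.2 ?_)
      have h1 := hpq (MeasurableEquiv.toLp 2 _ x) (MeasurableEquiv.toLp 2 _ y)
      have h2 : ⟪MeasurableEquiv.toLp 2 (Fin n → ℝ) x, MeasurableEquiv.toLp 2 (Fin n → ℝ) y⟫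
          = x ⬝ᵥ y := by
        rw [EuclideanSpace.inner_eq_star_dotProduct, dotProduct_comm]
        rfl
      rw [h2] at h1
      nlinarith [sq_nonneg (p (MeasurableEquiv.toLp 2 _ x) - q (MeasurableEquiv.toLp 2 _ y))]
  rw [lintegral_exp_neg_sq hp hp0 hps, lintegral_exp_neg_sq hq hq0 hqs, two_pi_pow_eq, ← hc] at key
  have hB : volume (Metric.ball (0 : EuclideanSpace ℝ (Fin n)) 1) ≠ 0 :=
    (Metric.measure_ball_pos _ _ one_pos).ne'
  have h2 := two_pi_pow_eq n
  rw [← hc] at h2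
  have hc0 : c ≠ 0 := by
    intro h
    rw [h, zero_mul, zero_pow two_ne_zero] at h2
    have : 0 < (2 * Real.pi) ^ n := by positivity
    simp [this.not_ge] at h2
  have hct : c ≠ ∞ := by
    intro h
    rw [h, ENNReal.top_mul hB] at h2
    simp at h2
  have h3 : c ^ 2 * (volume {x | p x ≤ 1} * volume {x | q x ≤ 1})
      ≤ c ^ 2 * volume (Metric.ball (0 : EuclideanSpace ℝ (Fin n)) 1) ^ 2 := by
    convert key using 1 <;> ring
  exact (ENNReal.mul_le_mul_iff_right (pow_ne_zero _ hc0) (ENNReal.pow_ne_top hct)).1 h3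

/-- The support function of a set. -/
noncomputable def supportFun {n : ℕ} (A : Set (EuclideanSpace ℝ (Fin n)))
    (y : EuclideanSpace ℝ (Fin n)) : ℝ :=
  sSup ((fun x => ⟪x, y⟫) '' A)

section Support

variable {n : ℕ} {A : Set (EuclideanSpace ℝ (Fin n))}

theorem inner_le_supportFun (hA : IsCompact A) {x : EuclideanSpace ℝ (Fin n)} (hx : x ∈ A)
    (y : EuclideanSpace ℝ (Fin n)) : ⟪x, y⟫ ≤ supportFun A y :=
  le_csSup (hA.image (by fun_prop)).bddAbove (mem_image_of_mem _ hx)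

theorem supportFun_le (hA : A.Nonempty) {y : EuclideanSpace ℝ (Fin n)} {c : ℝ}
    (h : ∀ x ∈ A, ⟪x, y⟫ ≤ c) : supportFun A y ≤ c :=
  csSup_le (hA.image _) (forall_mem_image.2 h)

theorem continuous_supportFun (hA : IsCompact A) : Continuous (supportFun A) :=
  hA.continuous_sSup (f := fun y x => ⟪x, y⟫) (by fun_prop)

theorem supportFun_nonneg (hA : IsCompact A) (h0 : 0 ∈ A) (y : EuclideanSpace ℝ (Fin n)) :
    0 ≤ supportFun A y := by
  simpa using inner_le_supportFun hA h0 y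

theorem supportFun_smul {r : ℝ} (hr : 0 < r) (y : EuclideanSpace ℝ (Fin n)) :
    supportFun A (r • y) = r * supportFun A y := by
  rw [supportFun, supportFun, ← smul_eq_mul, ← Real.sSup_smul_of_nonneg hr.le, ← image_smul,
    image_image]
  simp only [inner_smul_right, smul_eq_mul]

theorem setOf_supportFun_le_one (hA : IsCompact A) (hA0 : A.Nonempty) :
    {y | supportFun A y ≤ 1} = polarSet A :=
  Subset.antisymm (fun y hy _ hx => (inner_le_supportFun hA hx y).trans hy)
    fun _ hy => supportFun_le hA0 hy

theorem mul_norm_le_supportFun (hA : IsCompact A) {ε : ℝ} (hε : 0 ≤ ε)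
    (h : Metric.closedBall 0 ε ⊆ A) (y : EuclideanSpace ℝ (Fin n)) :
    ε * ‖y‖ ≤ supportFun A y := by
  rcases eq_or_ne y 0 with rfl | hy
  · simpa using supportFun_nonneg hA (h (by simpa using hε)) 0
  have hy' : ‖y‖ ≠ 0 := norm_ne_zero_iff.2 hy
  have hm : (ε / ‖y‖) • y ∈ A := by
    refine h ?_
    rw [mem_closedBall_zero_iff, norm_smul, Real.norm_of_nonneg (by positivity),
      div_mul_cancel₀ _ hy']
  refine le_trans (le_of_eq ?_) (inner_le_supportFun hA hm y)
  rw [real_inner_smul_left, real_inner_self_eq_norm_sq]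
  field_simp

theorem isClosed_polarSet (A : Set (EuclideanSpace ℝ (Fin n))) : IsClosed (polarSet A) := by
  have : polarSet A = ⋂ x ∈ A, {y | ⟪x, y⟫ ≤ 1} := by
    ext y; simp [polarSet]
  rw [this]
  exact isClosed_biInter fun x _ => isClosed_le (by fun_prop) (by fun_prop)

theorem polarSet_anti {A B : Set (EuclideanSpace ℝ (Fin n))} (h : A ⊆ B) :
    polarSet B ⊆ polarSet A := fun _ hy x hx => hy x (h hx)

theorem isCompact_polarSet (h : 0 ∈ interior A) : IsCompact (polarSet A) := by
  obtain ⟨ε, hε, hb⟩ := Metric.nhds_basis_closedBall.mem_iff.1 (mem_interior_iff_mem_nhds.1 h)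
  refine (isCompact_closedBall 0 (1 / ε)).of_isClosed_subset (isClosed_polarSet A) fun y hy => ?_
  rw [mem_closedBall_zero_iff, le_div_iff₀ hε, mul_comm]
  have hc := isCompact_closedBall (0 : EuclideanSpace ℝ (Fin n)) ε
  exact (mul_norm_le_supportFun hc hε.le Subset.rfl y).trans
    (supportFun_le ⟨0, by simpa using hε.le⟩ fun x hx => hy x (hb hx))

theorem polarSet_convexHull (A : Set (EuclideanSpace ℝ (Fin n))) :
    polarSet (convexHull ℝ A) = polarSet A := by
  refine Subset.antisymm (polarSet_anti (subset_convexHull ℝ A)) fun y hy x hx => ?_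
  have hc : Convex ℝ {x : EuclideanSpace ℝ (Fin n) | ⟪x, y⟫ ≤ 1} :=
    convex_halfSpace_le (f := fun x => ⟪x, y⟫)
      ⟨fun a b => inner_add_left a b y, fun c a => real_inner_smul_left a y c⟩ 1
  exact convexHull_min (fun x hx => hy x hx) hc hx

theorem isCompact_image_sub (hA : IsCompact A) (w : EuclideanSpace ℝ (Fin n)) :
    IsCompact ((fun x => x - w) '' A) :=
  hA.image (by fun_prop)

theorem zero_mem_image_sub {w : EuclideanSpace ℝ (Fin n)} (hw : w ∈ A) :
    (0 : EuclideanSpace ℝ (Fin n)) ∈ (fun x => x - w) '' A :=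
  ⟨w, hw, sub_self w⟩

theorem zero_mem_interior_image_sub {w : EuclideanSpace ℝ (Fin n)} (hw : w ∈ interior A) :
    (0 : EuclideanSpace ℝ (Fin n)) ∈ interior ((fun x => x - w) '' A) := by
  have h := (Homeomorph.subRight w).image_interior A
  simp only [Homeomorph.coe_subRight] at h
  rw [← h]
  exact zero_mem_image_sub hw

theorem supportFun_image_sub (hA : IsCompact A) (hA0 : A.Nonempty)
    (w y : EuclideanSpace ℝ (Fin n)) :
    supportFun ((fun x => x - w) '' A) y = supportFun A y - ⟪w, y⟫ := by
  refine le_antisymm (supportFun_le (hA0.image _) ?_) ?_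
  · rintro _ ⟨x, hx, rfl⟩
    rw [inner_sub_left]
    linarith [inner_le_supportFun hA hx y]
  · rw [sub_le_iff_le_add]
    refine supportFun_le hA0 fun x hx => ?_
    have := inner_le_supportFun (isCompact_image_sub hA w) (mem_image_of_mem _ hx) y
    rw [inner_sub_left] at this
    linarith

theorem lintegral_exp_neg_supportFun (hA : IsCompact A) (h0 : 0 ∈ A) :
    ∫⁻ y, ENNReal.ofReal (Real.exp (-supportFun A y))
      = ENNReal.ofReal n.factorial * volume (polarSet A) := by
  rw [lintegral_exp_neg (continuous_supportFun hA).measurable (supportFun_nonneg hA h0)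
    (fun r hr y => supportFun_smul hr y), setOf_supportFun_le_one hA ⟨0, h0⟩]

theorem integrable_exp_neg_supportFun (hA : IsCompact A) (h0 : 0 ∈ interior A) :
    Integrable fun y => Real.exp (-supportFun A y) := by
  have hm : Measurable (supportFun A) := (continuous_supportFun hA).measurable
  refine ⟨by fun_prop, ?_⟩
  rw [hasFiniteIntegral_iff_ofReal (ae_of_all _ fun _ => (Real.exp_pos _).le),
    lintegral_exp_neg_supportFun hA (interior_subset h0)]
  exact ENNReal.mul_lt_top ENNReal.ofReal_lt_top (isCompact_polarSet h0).measure_lt_top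

end Support

open Filter Topology ProbabilityTheory in
/-- At the Santaló point, the measure with density `exp (-h)`, where `h` is the support function
of the translated body, is centered. -/
theorem integral_mul_exp_neg_supportFun_eq_zero {n : ℕ} {L : Set (EuclideanSpace ℝ (Fin n))}
    (hL : IsCompact L) {z : EuclideanSpace ℝ (Fin n)} (hz : z ∈ interior L)
    (hmin : ∀ w ∈ interior L, volume (polarSet ((fun x => x - z) '' L))
      ≤ volume (polarSet ((fun x => x - w) '' L))) (i : Fin n) :
    Integrable (fun y : EuclideanSpace ℝ (Fin n) =>
        y i * Real.exp (-supportFun ((fun x => x - z) '' L) y)) ∧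
      ∫ y : EuclideanSpace ℝ (Fin n),
        y i * Real.exp (-supportFun ((fun x => x - z) '' L) y) = 0 := by
  set p := supportFun ((fun x => x - z) '' L) with hp
  have hpm : Measurable p := (continuous_supportFun (isCompact_image_sub hL z)).measurable
  set μ : Measure (EuclideanSpace ℝ (Fin n)) :=
    volume.withDensity fun y => ENNReal.ofReal (Real.exp (-p y)) with hμ
  set X : EuclideanSpace ℝ (Fin n) → ℝ := fun y => y i with hX
  set e : EuclideanSpace ℝ (Fin n) := EuclideanSpace.single i 1 with he
  have hne : L.Nonempty := ⟨z, interior_subset hz⟩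
  have hev : ∀ᶠ t in 𝓝 (0 : ℝ), z + t • e ∈ interior L := by
    have hc : ContinuousAt (fun t : ℝ => z + t • e) 0 := by fun_prop
    exact hc.eventually_mem (by simpa using isOpen_interior.mem_nhds hz)
  have hlin : ∀ t : ℝ, z + t • e ∈ interior L →
      ∫⁻ y, ENNReal.ofReal (Real.exp (t * X y)) ∂μ
        = ENNReal.ofReal n.factorial * volume (polarSet ((fun x => x - (z + t • e)) '' L)) := by
    intro t ht
    rw [hμ, lintegral_withDensity_eq_lintegral_mul _ (by fun_prop) (by fun_prop),
      ← lintegral_exp_neg_supportFun (isCompact_image_sub hL _)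
        (zero_mem_image_sub (interior_subset ht))]
    refine lintegral_congr fun y => ?_
    rw [Pi.mul_apply, ← ENNReal.ofReal_mul (Real.exp_pos _).le, ← Real.exp_add, hp,
      supportFun_image_sub hL hne, supportFun_image_sub hL hne, inner_add_left,
      real_inner_smul_left, he, EuclideanSpace.inner_single_left]
    congr 2
    simp [hX]; ring
  have hfin : ∀ t : ℝ, z + t • e ∈ interior L →
      ∫⁻ y, ENNReal.ofReal (Real.exp (t * X y)) ∂μ < ∞ := by
    intro t ht
    rw [hlin t ht]
    exact ENNReal.mul_lt_top ENNReal.ofReal_lt_top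
      (isCompact_polarSet (zero_mem_interior_image_sub ht)).measure_lt_top
  have h0 : (0 : ℝ) ∈ interior (integrableExpSet X μ) := by
    rw [mem_interior_iff_mem_nhds]
    filter_upwards [hev] with t ht
    refine ⟨by fun_prop, ?_⟩
    rw [hasFiniteIntegral_iff_ofReal (ae_of_all _ fun _ => (Real.exp_pos _).le)]
    exact hfin t ht
  have hmgf : ∀ t, mgf X μ t = (∫⁻ y, ENNReal.ofReal (Real.exp (t * X y)) ∂μ).toReal := fun t =>
    integral_eq_lintegral_of_nonneg_ae (ae_of_all _ fun _ => (Real.exp_pos _).le) (by fun_prop)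
  have hloc : IsLocalMin (mgf X μ) 0 := by
    filter_upwards [hev] with t ht
    rw [hmgf, hmgf]
    refine ENNReal.toReal_mono (hfin t ht).ne ?_
    rw [hlin t ht, hlin 0 (by simpa using hz)]
    simp only [zero_smul, add_zero]
    exact mul_le_mul' le_rfl (hmin _ ht)
  have hd : μ[X] = 0 := by
    rw [← deriv_mgf_zero h0]; exact hloc.deriv_eq_zero
  have hXi : Integrable X μ := integrable_of_mem_interior_integrableExpSet h0
  have hfm : Measurable fun y => ENNReal.ofReal (Real.exp (-p y)) := by fun_prop
  rw [hμ, integrable_withDensity_iff hfm (ae_of_all _ fun _ => ENNReal.ofReal_lt_top)] at hXi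
  rw [hμ, integral_withDensity_eq_integral_toReal_smul hfm
    (ae_of_all _ fun _ => ENNReal.ofReal_lt_top)] at hd
  simp only [ENNReal.toReal_ofReal (Real.exp_pos _).le, smul_eq_mul] at hXi hd
  refine ⟨hXi, ?_⟩
  rw [← hd]
  exact integral_congr_ae (ae_of_all _ fun y => mul_comm _ _)

theorem volume_mul_le_lintegral_exp {n : ℕ} {K : Set (EuclideanSpace ℝ (Fin n))}
    (hK : IsCompact K) (hKvol : 0 < volume K) {h : EuclideanSpace ℝ (Fin n) → ℝ}
    (hhs : ∀ r > 0, ∀ y, h (r • y) = r * h y)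
    (hhK : ∀ x ∈ K, h x ≤ 1) (z : EuclideanSpace ℝ (Fin n))
    (ha : 0 < 1 - ⟪z, (volume K).toReal⁻¹ • ∫ x in K, x⟫) :
    volume K * ENNReal.ofReal
        ((1 / (1 - ⟪z, (volume K).toReal⁻¹ • ∫ x in K, x⟫)) ^ (n + 1) * n.factorial)
      ≤ ∫⁻ y, ENNReal.ofReal (Real.exp (-(h y - ⟪z, y⟫))) := by
  set b := (volume K).toReal⁻¹ • ∫ x in K, x with hb
  have hid : IntegrableOn (fun x : EuclideanSpace ℝ (Fin n) => x) K :=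
    continuous_id.continuousOn.integrableOn_compact hK
  have hV : (volume K).toReal ≠ 0 := (ENNReal.toReal_pos hKvol.ne' hK.measure_lt_top.ne).ne'
  have hzb : ∫ x in K, ⟪z, x⟫ = (volume K).toReal * ⟪z, b⟫ := by
    rw [integral_inner hid, hb, real_inner_smul_right]
    field_simp
  have hzi : IntegrableOn (fun x => ⟪z, x⟫) K := hid.const_inner z
  have jensen : ∀ r : ℝ, volume K * ENNReal.ofReal (Real.exp (r * ⟪z, b⟫))
      ≤ ∫⁻ x in K, ENNReal.ofReal (Real.exp ⟪z, r • x⟫) := by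
    intro r
    have hci : IntegrableOn (fun _ : EuclideanSpace ℝ (Fin n) => ⟪z, b⟫) K :=
      integrableOn_const hK.measure_lt_top.ne
    have h1 := lintegral_le_lintegral_mul_exp (μ := volume.restrict K) (f := fun _ => 1)
      (l := fun x => r * (⟪z, x⟫ - ⟪z, b⟫)) (fun _ => zero_le_one)
      (integrableOn_const hK.measure_lt_top.ne)
      (by simpa using (hzi.sub hci).const_mul r)
      (by
        simp only [mul_one]
        rw [integral_const_mul, integral_sub hzi hci, hzb, setIntegral_const, smul_eq_mul,
          Measure.real, sub_self, mul_zero])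
    simp only [ENNReal.ofReal_one, lintegral_const, Measure.restrict_apply_univ, one_mul] at h1
    calc _ ≤ (∫⁻ x in K, ENNReal.ofReal (Real.exp (r * (⟪z, x⟫ - ⟪z, b⟫))))
          * ENNReal.ofReal (Real.exp (r * ⟪z, b⟫)) := by gcongr
      _ = _ := by
        rw [← lintegral_mul_const _ (by fun_prop)]
        refine lintegral_congr fun x => ?_
        rw [← ENNReal.ofReal_mul (Real.exp_pos _).le, ← Real.exp_add, real_inner_smul_right z x r]
        congr 2; ring
  have hcone := lintegral_mul_lintegral_indicator_inv_smul hK.measurableSet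
    (w := fun y => ENNReal.ofReal (Real.exp ⟪z, y⟫)) (by fun_prop)
    (ψ := fun r => ENNReal.ofReal (Real.exp (-r))) (by fun_prop)
  calc _ = ∫⁻ r in Ioi 0, volume K * (ENNReal.ofReal (Real.exp (-((1 - ⟪z, b⟫) * r)))
          * ENNReal.ofReal (r ^ n)) := by
        rw [lintegral_const_mul _ (by fun_prop), lintegral_Ioi_exp_neg_mul_pow n ha]
    _ ≤ ∫⁻ r in Ioi 0, ENNReal.ofReal (Real.exp (-r)) * ENNReal.ofReal (r ^ n)
          * ∫⁻ x in K, ENNReal.ofReal (Real.exp ⟪z, r • x⟫) := by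
        refine lintegral_mono fun r => ?_
        calc _ = ENNReal.ofReal (Real.exp (-r)) * ENNReal.ofReal (r ^ n)
              * (volume K * ENNReal.ofReal (Real.exp (r * ⟪z, b⟫))) := by
              rw [show -((1 - ⟪z, b⟫) * r) = -r + r * ⟪z, b⟫ by ring, Real.exp_add,
                ENNReal.ofReal_mul (Real.exp_pos _).le]
              ring
          _ ≤ _ := by gcongr; exact jensen r
    _ = _ := hcone.symm
    _ ≤ _ := by
        refine lintegral_mono fun y => ?_
        rw [show -(h y - ⟪z, y⟫) = ⟪z, y⟫ + -h y by ring, Real.exp_add,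
          ENNReal.ofReal_mul (Real.exp_pos _).le]
        refine mul_le_mul' le_rfl ?_
        rw [← lintegral_Ioi_exp_neg, setLIntegral_congr (Ioi_ae_eq_Ici (a := h y)),
          ← lintegral_indicator measurableSet_Ici, ← lintegral_indicator measurableSet_Ioi]
        refine lintegral_mono (indicator_le fun r hr => ?_)
        have hr : 0 < r := hr
        refine indicator_apply_le' (fun hy => ?_) fun _ => zero_le
        have h1 := hhK _ hy
        rw [hhs _ (inv_pos.2 hr), inv_mul_le_iff₀ hr, mul_one] at h1
        rw [indicator_of_mem (mem_Ici.2 h1)]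

theorem inner_barycenter_lt_one {n : ℕ} {K : Set (EuclideanSpace ℝ (Fin n))}
    (hK : IsCompact K) (hKvol : 0 < volume K) {z : EuclideanSpace ℝ (Fin n)}
    (hz : z ∈ interior (polarSet K)) : ⟪z, (volume K).toReal⁻¹ • ∫ x in K, x⟫ < 1 := by
  have hev : ∀ᶠ t in nhds (1 : ℝ), t • z ∈ interior (polarSet K) := by
    have hc : ContinuousAt (fun t : ℝ => t • z) 1 := by fun_prop
    exact hc.eventually_mem (by simpa using isOpen_interior.mem_nhds hz)
  obtain ⟨t, ht, ht1⟩ := ((hev.filter_mono nhdsWithin_le_nhds).and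
    (self_mem_nhdsWithin : Ioi (1 : ℝ) ∈ nhdsWithin 1 (Ioi 1))).exists
  have ht1 : 1 < t := ht1
  have ht0 : 0 < t := one_pos.trans ht1
  have hid : IntegrableOn (fun x : EuclideanSpace ℝ (Fin n) => x) K :=
    continuous_id.continuousOn.integrableOn_compact hK
  have hV : 0 < (volume K).toReal := ENNReal.toReal_pos hKvol.ne' hK.measure_lt_top.ne
  have hle : ∫ x in K, ⟪z, x⟫ ≤ ∫ _ in K, t⁻¹ := by
    refine setIntegral_mono_on (hid.const_inner z) (integrableOn_const hK.measure_lt_top.ne)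
      hK.measurableSet fun x hx => ?_
    have h1 := interior_subset ht x hx
    rw [real_inner_smul_right, real_inner_comm] at h1
    rwa [← one_div, le_div_iff₀ ht0, mul_comm]
  rw [integral_inner hid, setIntegral_const, smul_eq_mul, Measure.real] at hle
  rw [real_inner_smul_right]
  calc _ ≤ (volume K).toReal⁻¹ * ((volume K).toReal * t⁻¹) := by gcongr
    _ = t⁻¹ := by field_simp
    _ < 1 := inv_lt_one_of_one_lt₀ ht1

theorem inner_le_supportFun_mul_supportFun_polarSet {n : ℕ} {A : Set (EuclideanSpace ℝ (Fin n))}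
    (hA : IsCompact A) (h0 : 0 ∈ interior A) (x y : EuclideanSpace ℝ (Fin n)) :
    ⟪x, y⟫ ≤ supportFun A x * supportFun (polarSet A) y := by
  rcases eq_or_ne x 0 with rfl | hx
  · rw [inner_zero_left]
    exact mul_nonneg (supportFun_nonneg hA (interior_subset h0) 0)
      (supportFun_nonneg (isCompact_polarSet h0) (fun x _ => by simp) y)
  obtain ⟨ε, hε, hb⟩ := Metric.nhds_basis_closedBall.mem_iff.1 (mem_interior_iff_mem_nhds.1 h0)
  have hpos : 0 < supportFun A x :=
    (mul_pos hε (norm_pos_iff.2 hx)).trans_le (mul_norm_le_supportFun hA hε.le hb x)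
  have hm : (supportFun A x)⁻¹ • x ∈ polarSet A := by
    rw [← setOf_supportFun_le_one hA ⟨0, interior_subset h0⟩, mem_ofPred_eq,
      supportFun_smul (inv_pos.2 hpos), inv_mul_cancel₀ hpos.ne']
  have h := inner_le_supportFun (isCompact_polarSet h0) hm y
  rwa [real_inner_smul_left, inv_mul_le_iff₀ hpos] at h

/-- Blaschke-Santaló inequality for compact sets: if `K` is compact with `|K| > 0` and
`0 ∈ int(conv K)`, and `z` is a minimizer, over the interior of `K°`, of
`w ↦ |(K° − w)°|` (i.e. `z = San(K°)` is the Santaló point of `K°`), then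
`|K|·|K°| ≤ |B₂ⁿ|² · (1 − ⟨z, bar(K)⟩)^{n+1}`. -/
theorem blaschke_santalo_compact (n : ℕ) (K : Set (EuclideanSpace ℝ (Fin n)))
    (hKcomp : IsCompact K) (hKvol : 0 < volume K)
    (h0 : (0 : EuclideanSpace ℝ (Fin n)) ∈ interior (convexHull ℝ K))
    (z : EuclideanSpace ℝ (Fin n)) (hz : z ∈ interior (polarSet K))
    (hzmin : ∀ w ∈ interior (polarSet K),
      volume (polarSet ((fun x => x - z) '' polarSet K))
        ≤ volume (polarSet ((fun x => x - w) '' polarSet K))) :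
    volume K * volume (polarSet K)
      ≤ (volume (Metric.ball (0 : EuclideanSpace ℝ (Fin n)) 1)) ^ 2
        * ENNReal.ofReal ((1 - ⟪z, (volume K).toReal⁻¹ • ∫ x in K, x ∂volume⟫) ^ (n + 1)) := by
  have hL : IsCompact (polarSet K) := polarSet_convexHull K ▸ isCompact_polarSet h0
  have h0L : (0 : EuclideanSpace ℝ (Fin n)) ∈ polarSet K := fun x _ => by simp
  have hzL := interior_subset hz
  have ha := sub_pos.2 (inner_barycenter_lt_one hKcomp hKvol hz)
  set a := 1 - ⟪z, (volume K).toReal⁻¹ • ∫ x in K, x⟫ with ha_def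
  set Lz := (fun x => x - z) '' polarSet K with hLz
  have cLz : IsCompact Lz := isCompact_image_sub hL z
  have zLz : 0 ∈ Lz := zero_mem_image_sub hzL
  have iLz : 0 ∈ interior Lz := zero_mem_interior_image_sub hz
  have cM : IsCompact (polarSet Lz) := isCompact_polarSet iLz
  have zM : (0 : EuclideanSpace ℝ (Fin n)) ∈ polarSet Lz := fun x _ => by simp
  have hjensen : volume K ≤ volume (polarSet Lz) * ENNReal.ofReal (a ^ (n + 1)) := by
    have h1 := volume_mul_le_lintegral_exp hKcomp hKvol (fun r hr y => supportFun_smul hr y)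
      (fun x hx => supportFun_le ⟨0, h0L⟩ fun y hy => by
        rw [real_inner_comm]; exact hy x hx) z ha
    simp only [← supportFun_image_sub hL ⟨0, h0L⟩ z] at h1
    rw [lintegral_exp_neg_supportFun cLz zLz, ← ha_def] at h1
    have hf : (0 : ℝ) < n.factorial := by positivity
    have h2 : volume K * ENNReal.ofReal ((1 / a) ^ (n + 1) * n.factorial)
          * ENNReal.ofReal (a ^ (n + 1) / n.factorial)
        ≤ ENNReal.ofReal n.factorial * volume (polarSet Lz)
          * ENNReal.ofReal (a ^ (n + 1) / n.factorial) := by gcongr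
    have e1 : ENNReal.ofReal ((1 / a) ^ (n + 1) * n.factorial)
        * ENNReal.ofReal (a ^ (n + 1) / n.factorial) = 1 := by
      rw [← ENNReal.ofReal_mul (by positivity), ← ENNReal.ofReal_one]
      congr 1
      rw [one_div, inv_pow]
      field_simp
    have e2 : ENNReal.ofReal n.factorial * ENNReal.ofReal (a ^ (n + 1) / n.factorial)
        = ENNReal.ofReal (a ^ (n + 1)) := by
      rw [← ENNReal.ofReal_mul (by positivity)]
      congr 1
      field_simp
    rw [mul_assoc, e1, mul_one, mul_right_comm, e2, mul_comm] at h2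
    exact h2
  have hsantalo : volume (polarSet Lz) * volume (polarSet K)
      ≤ volume (Metric.ball (0 : EuclideanSpace ℝ (Fin n)) 1) ^ 2 := by
    have hle : volume (polarSet K) ≤ volume (polarSet (polarSet Lz)) := by
      rw [← measure_preimage_add_right volume z (polarSet K)]
      refine measure_mono fun x hx y hy => ?_
      rw [real_inner_comm]
      exact hy x ⟨x + z, hx, add_sub_cancel_right x z⟩
    refine (mul_le_mul' le_rfl hle).trans ?_
    rw [← setOf_supportFun_le_one cM ⟨0, zM⟩]
    nth_rw 1 [← setOf_supportFun_le_one cLz ⟨0, zLz⟩]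
    refine volume_mul_volume_le_of_inner_le (continuous_supportFun cLz).measurable
      (supportFun_nonneg cLz zLz) (fun r hr y => supportFun_smul hr y)
      (continuous_supportFun cM).measurable (supportFun_nonneg cM zM)
      (fun r hr y => supportFun_smul hr y) ?_ (integrable_exp_neg_supportFun cLz iLz)
      (fun i => (integral_mul_exp_neg_supportFun_eq_zero hL hz hzmin i).1)
      (fun i => (integral_mul_exp_neg_supportFun_eq_zero hL hz hzmin i).2)
    exact inner_le_supportFun_mul_supportFun_polarSet cLz iLz
  calc volume K * volume (polarSet K)
      ≤ volume (polarSet Lz) * ENNReal.ofReal (a ^ (n + 1)) * volume (polarSet K) := by gcongr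
    _ = volume (polarSet Lz) * volume (polarSet K) * ENNReal.ofReal (a ^ (n + 1)) := by ring
    _ ≤ _ := by gcongr
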